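/- arXiv:1810.10842 — 2 statements merged into one kernel-verified Lean document; each statement's English description precedes it below -/
import Mathlib

section
/- There exist absolute constants c > 0 and C > 0 such that for every finite set A ⊆ ℝ with |A| ≥ 2, writing S := A+A and assuming 0 ∉ S, one has |SSSS/SSSS| ≥ c · |A|^(100/49) / (log |A|)^C. -/
open Finset Pointwise

/-- The number of points of the grid `X × Y` on the line `y = ℓ.1 * x + ℓ.2`. -/
noncomputable def lineCount (X Y : Finset ℝ) (ℓ : ℝ × ℝ) : ℕ :=
  #{p ∈ X ×ˢ Y | p.2 = ℓ.1 * p.1 + ℓ.2}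

/-- A finite set of reals splits into `r` consecutive blocks of at most `s` elements. -/
lemma exists_monotone_blocks (X : Finset ℝ) (r s : ℕ) (h : #X ≤ r * s) :
    ∃ i : ℝ → ℕ, Monotone i ∧ (∀ x ∈ X, i x < r) ∧ ∀ k, #{x ∈ X | i x = k} ≤ s := by
  have hlt : ∀ x ∈ X, #{z ∈ X | z < x} < #X := fun x hx =>
    card_lt_card (filter_ssubset.2 ⟨x, hx, by simp⟩)
  have hmono : ∀ x y : ℝ, x ≤ y → #{z ∈ X | z < x} ≤ #{z ∈ X | z < y} := by
    intro x y hxy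
    apply card_le_card
    intro z
    simp only [mem_filter]
    exact fun hz => ⟨hz.1, hz.2.trans_le hxy⟩
  have hstrict : ∀ x ∈ X, ∀ y, x < y → #{z ∈ X | z < x} < #{z ∈ X | z < y} := by
    intro x hx y hxy
    apply card_lt_card
    refine ⟨fun z hz => ?_, fun hs => ?_⟩
    · simp only [mem_filter] at hz ⊢
      exact ⟨hz.1, hz.2.trans hxy⟩
    · have := hs (mem_filter.2 ⟨hx, hxy⟩)
      simp at this
  refine ⟨fun x => #{z ∈ X | z < x} / s, fun x y hxy => Nat.div_le_div_right (hmono x y hxy),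
    fun x hx => ?_, fun k => ?_⟩
  · exact Nat.div_lt_of_lt_mul ((hlt x hx).trans_le (h.trans_eq (mul_comm _ _)))
  · rcases Nat.eq_zero_or_pos s with rfl | hs
    · simp only [mul_zero, nonpos_iff_eq_zero, card_eq_zero] at h
      simp [h]
    · have : #{x ∈ X | #{z ∈ X | z < x} / s = k} ≤ #(Finset.Ico (k * s) (k * s + s)) := by
        apply card_le_card_of_injOn (fun x => #{z ∈ X | z < x})
        · intro x hx
          simp only [coe_filter, Set.mem_ofPred_eq] at hx
          have h1 := (Nat.div_eq_iff hs).1 hx.2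
          simp only [coe_Ico, Set.mem_Ico]
          omega
        · intro x hx y hy hxy
          simp only [coe_filter, Set.mem_ofPred_eq] at hx hy hxy
          rcases lt_trichotomy x y with h' | h' | h'
          · exact absurd hxy (hstrict x hx.1 y h').ne
          · exact h'
          · exact absurd hxy (hstrict y hy.1 x h').ne'
      simpa using this

lemma card_le_card_image_add_collisions {α β : Type*} [DecidableEq α] [DecidableEq β]
    (T : Finset α) (f : α → β) :
    #T ≤ #(T.image f) + #{p ∈ T ×ˢ T | p.1 ≠ p.2 ∧ f p.1 = f p.2} := by
  induction T using Finset.induction_on with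
  | empty => simp
  | insert a T ha ih =>
    rw [card_insert_of_notMem ha, image_insert]
    have hsub : {p ∈ T ×ˢ T | p.1 ≠ p.2 ∧ f p.1 = f p.2} ⊆
        {p ∈ insert a T ×ˢ insert a T | p.1 ≠ p.2 ∧ f p.1 = f p.2} := by
      intro p
      simp only [mem_filter, mem_product, mem_insert]
      tauto
    by_cases hfa : f a ∈ T.image f
    · rw [insert_eq_of_mem hfa]
      obtain ⟨b, hb, hab⟩ := mem_image.1 hfa
      have : #{p ∈ T ×ˢ T | p.1 ≠ p.2 ∧ f p.1 = f p.2} <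
          #{p ∈ insert a T ×ˢ insert a T | p.1 ≠ p.2 ∧ f p.1 = f p.2} := by
        apply card_lt_card
        refine ⟨hsub, fun hs => ?_⟩
        have hm : (a, b) ∈ {p ∈ T ×ˢ T | p.1 ≠ p.2 ∧ f p.1 = f p.2} := by
          apply hs
          exact mem_filter.2 ⟨mem_product.2 ⟨mem_insert_self _ _, mem_insert_of_mem hb⟩,
            fun h => ha ((show b = a from h.symm) ▸ hb), hab.symm⟩
        simp only [mem_filter, mem_product] at hm
        exact ha hm.1.1
      omega
    · rw [card_insert_of_notMem hfa]
      have := card_le_card hsub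
      omega

/-- A non-axis-parallel line meets few cells of a monotone `r × r` subdivision. -/
lemma card_image_cells_le (X Y : Finset ℝ) (r : ℕ) (i j : ℝ → ℕ) (hi : Monotone i)
    (hj : Monotone j) (hir : ∀ x ∈ X, i x < r) (hjr : ∀ y ∈ Y, j y < r) (ℓ : ℝ × ℝ)
    (hℓ : ℓ.1 ≠ 0) :
    #({p ∈ X ×ˢ Y | p.2 = ℓ.1 * p.1 + ℓ.2}.image fun p => (i p.1, j p.2)) ≤ 2 * r := by
  rw [← card_range (2 * r)]
  rcases lt_or_gt_of_ne hℓ with hneg | hpos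
  · apply card_le_card_of_injOn (fun q => q.1 + (r - q.2))
    · intro q hq
      simp only [coe_image, coe_filter, mem_product, Set.mem_image, Set.mem_ofPred_eq] at hq
      obtain ⟨p, ⟨⟨hx, hy⟩, -⟩, rfl⟩ := hq
      have := hir _ hx
      have := hjr _ hy
      simp only [coe_range, Set.mem_Iio]
      omega
    · intro q hq q' hq' hqq
      simp only [coe_image, coe_filter, mem_product, Set.mem_image, Set.mem_ofPred_eq] at hq hq'
      obtain ⟨p, ⟨⟨hx, hy⟩, h⟩, rfl⟩ := hq
      obtain ⟨p', ⟨⟨hx', hy'⟩, h'⟩, rfl⟩ := hq'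
      have h1 := hjr _ hy
      have h2 := hjr _ hy'
      simp only at hqq
      rcases le_total p.1 p'.1 with hle | hle
      · have h3 : p'.2 ≤ p.2 := by rw [h, h']; nlinarith
        have := hi hle
        have := hj h3
        simp only [Prod.mk.injEq]
        omega
      · have h3 : p.2 ≤ p'.2 := by rw [h, h']; nlinarith
        have := hi hle
        have := hj h3
        simp only [Prod.mk.injEq]
        omega
  · apply card_le_card_of_injOn (fun q => q.1 + q.2)
    · intro q hq
      simp only [coe_image, coe_filter, mem_product, Set.mem_image, Set.mem_ofPred_eq] at hq
      obtain ⟨p, ⟨⟨hx, hy⟩, -⟩, rfl⟩ := hq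
      have := hir _ hx
      have := hjr _ hy
      simp only [coe_range, Set.mem_Iio]
      omega
    · intro q hq q' hq' hqq
      simp only [coe_image, coe_filter, mem_product, Set.mem_image, Set.mem_ofPred_eq] at hq hq'
      obtain ⟨p, ⟨⟨hx, hy⟩, h⟩, rfl⟩ := hq
      obtain ⟨p', ⟨⟨hx', hy'⟩, h'⟩, rfl⟩ := hq'
      simp only at hqq
      rcases le_total p.1 p'.1 with hle | hle
      · have h3 : p.2 ≤ p'.2 := by rw [h, h']; nlinarith
        have := hi hle
        have := hj h3
        simp only [Prod.mk.injEq]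
        omega
      · have h3 : p'.2 ≤ p.2 := by rw [h, h']; nlinarith
        have := hi hle
        have := hj h3
        simp only [Prod.mk.injEq]
        omega

/-- Two distinct points of a grid lie on at most one line, counted over the pairs with a
given property. -/
lemma sum_card_pairs_le (P : Finset (ℝ × ℝ)) (L : Finset (ℝ × ℝ))
    (R : (ℝ × ℝ) → (ℝ × ℝ) → Prop) [DecidableRel R] :
    ∑ ℓ ∈ L, #{q ∈ {p ∈ P | p.2 = ℓ.1 * p.1 + ℓ.2} ×ˢ {p ∈ P | p.2 = ℓ.1 * p.1 + ℓ.2} |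
      q.1 ≠ q.2 ∧ R q.1 q.2} ≤ #{q ∈ P ×ˢ P | R q.1 q.2} := by
  rw [← card_sigma]
  apply card_le_card_of_injOn (fun z => z.2)
  · rintro ⟨ℓ, q⟩ hz
    simp only [coe_sigma, coe_filter, mem_product, mem_filter, Set.mem_sigma_iff, mem_coe,
      Set.mem_ofPred_eq] at hz ⊢
    tauto
  · rintro ⟨⟨m, c⟩, ⟨p, q⟩⟩ hz ⟨⟨m', c'⟩, ⟨p', q'⟩⟩ hz' h
    simp only [coe_sigma, coe_filter, mem_product, mem_filter, Set.mem_sigma_iff, mem_coe,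
      Set.mem_ofPred_eq] at hz hz' h
    obtain ⟨rfl, rfl⟩ := Prod.mk.inj h
    obtain ⟨-, ⟨⟨-, h1⟩, -, h2⟩, hne, -⟩ := hz
    obtain ⟨-, ⟨⟨-, h3⟩, -, h4⟩, -, -⟩ := hz'
    have hx : p.1 - q.1 ≠ 0 := by
      intro h0
      apply hne
      have : p.1 = q.1 := by linarith
      exact Prod.ext this (by rw [h1, h2, this])
    have hm : m = m' := by
      apply mul_right_cancel₀ hx
      linarith
    subst hm
    have hc : c = c' := by linarith
    subst hc
    rfl

lemma lineCount_le_left (X Y : Finset ℝ) (ℓ : ℝ × ℝ) : lineCount X Y ℓ ≤ #X := by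
  apply card_le_card_of_injOn (fun p => p.1)
  · intro p hp
    simp only [coe_filter, mem_product, Set.mem_ofPred_eq] at hp
    exact hp.1.1
  · intro p hp q hq h
    simp only [coe_filter, mem_product, Set.mem_ofPred_eq] at hp hq h
    exact Prod.ext h (by rw [hp.2, hq.2, h])

lemma lineCount_le_right (X Y : Finset ℝ) (ℓ : ℝ × ℝ) (hℓ : ℓ.1 ≠ 0) :
    lineCount X Y ℓ ≤ #Y := by
  apply card_le_card_of_injOn (fun p => p.2)
  · intro p hp
    simp only [coe_filter, mem_product, Set.mem_ofPred_eq] at hp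
    exact hp.1.2
  · intro p hp q hq h
    simp only [coe_filter, mem_product, Set.mem_ofPred_eq] at hp hq h
    refine Prod.ext (mul_left_cancel₀ hℓ ?_) h
    linarith

lemma sum_lineCount_le_of_blocks (X Y : Finset ℝ) (L : Finset (ℝ × ℝ))
    (hL : ∀ ℓ ∈ L, ℓ.1 ≠ 0) (r s t : ℕ) (hs : #X ≤ r * s) (ht : #Y ≤ r * t) :
    ∑ ℓ ∈ L, lineCount X Y ℓ ≤ 2 * r * #L + (#X * #Y) * (s * t) := by
  obtain ⟨i, hi, hir, his⟩ := exists_monotone_blocks X r s hs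
  obtain ⟨j, hj, hjr, hjt⟩ := exists_monotone_blocks Y r t ht
  have hpairs : #{q ∈ (X ×ˢ Y) ×ˢ (X ×ˢ Y) | (i q.1.1, j q.1.2) = (i q.2.1, j q.2.2)} ≤
      (#X * #Y) * (s * t) := by
    rw [← card_product X Y, card_filter, sum_product]
    rw [← smul_eq_mul (#(X ×ˢ Y))]
    apply sum_le_card_nsmul
    intro p _
    rw [← card_filter]
    calc #{q ∈ X ×ˢ Y | (i p.1, j p.2) = (i q.1, j q.2)}
        ≤ #({x ∈ X | i x = i p.1} ×ˢ {y ∈ Y | j y = j p.2}) := by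
          apply card_le_card
          intro q
          simp only [mem_filter, mem_product, Prod.mk.injEq]
          rintro ⟨⟨h1, h2⟩, h3, h4⟩
          exact ⟨⟨h1, h3.symm⟩, h2, h4.symm⟩
      _ ≤ s * t := by
          rw [card_product]
          exact Nat.mul_le_mul (his _) (hjt _)
  have hcount : ∀ ℓ ∈ L, lineCount X Y ℓ ≤ 2 * r +
      #{q ∈ {p ∈ X ×ˢ Y | p.2 = ℓ.1 * p.1 + ℓ.2} ×ˢ {p ∈ X ×ˢ Y | p.2 = ℓ.1 * p.1 + ℓ.2} |
        q.1 ≠ q.2 ∧ (i q.1.1, j q.1.2) = (i q.2.1, j q.2.2)} := fun ℓ hℓ =>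
    (card_le_card_image_add_collisions _ fun p : ℝ × ℝ => (i p.1, j p.2)).trans
      (Nat.add_le_add_right (card_image_cells_le X Y r i j hi hj hir hjr ℓ (hL ℓ hℓ)) _)
  calc ∑ ℓ ∈ L, lineCount X Y ℓ ≤ _ := sum_le_sum hcount
    _ ≤ 2 * r * #L + (#X * #Y) * (s * t) := by
      rw [sum_add_distrib, sum_const, smul_eq_mul, mul_comm (#L)]
      exact Nat.add_le_add_left ((sum_card_pairs_le (X ×ˢ Y) L
        (fun p q => (i p.1, j p.2) = (i q.1, j q.2))).trans hpairs) _

/-- Szemerédi–Trotter for Cartesian products. -/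
theorem sum_lineCount_pow_three_le (X Y : Finset ℝ) (L : Finset (ℝ × ℝ))
    (hL : ∀ ℓ ∈ L, ℓ.1 ≠ 0) :
    (∑ ℓ ∈ L, lineCount X Y ℓ) ^ 3 ≤ 13824 * ((#X * #Y) ^ 2 * #L ^ 2 + #L ^ 3) := by
  set I := ∑ ℓ ∈ L, lineCount X Y ℓ with hI
  set p := #X * #Y with hp
  set l := #L with hl
  have hsmall : ∀ n, (∀ ℓ ∈ L, lineCount X Y ℓ ≤ n) → I ≤ n * l := by
    intro n hn
    have := sum_le_card_nsmul L _ n hn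
    rw [smul_eq_mul, mul_comm] at this
    exact this
  rcases Nat.eq_zero_or_pos l with hl0 | hl0
  · have : L = ∅ := card_eq_zero.1 hl0
    simp [hI, this]
  have hblocks : ∀ r, 1 ≤ r → r ≤ #X → r ≤ #Y → r ^ 2 * I ≤ 2 * r ^ 3 * l + 4 * p ^ 2 := by
    intro r hr hrX hrY
    have h1 := sum_lineCount_le_of_blocks X Y L hL r (#X / r + 1) (#Y / r + 1)
      (Nat.lt_mul_div_succ _ hr).le (Nat.lt_mul_div_succ _ hr).le
    have hs : r * (#X / r + 1) ≤ 2 * #X := by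
      have := Nat.mul_div_le (#X) r
      rw [mul_add]; omega
    have ht : r * (#Y / r + 1) ≤ 2 * #Y := by
      have := Nat.mul_div_le (#Y) r
      rw [mul_add]; omega
    calc r ^ 2 * I ≤ r ^ 2 * (2 * r * l + p * ((#X / r + 1) * (#Y / r + 1))) :=
          Nat.mul_le_mul_left _ h1
      _ = 2 * r ^ 3 * l + p * ((r * (#X / r + 1)) * (r * (#Y / r + 1))) := by ring
      _ ≤ 2 * r ^ 3 * l + p * ((2 * #X) * (2 * #Y)) := by gcongr
      _ = 2 * r ^ 3 * l + 4 * p ^ 2 := by rw [hp]; ring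
  rcases Nat.eq_zero_or_pos p with hp0 | hp0
  · have : I ≤ 0 * l := by
      rcases Nat.mul_eq_zero.1 (hp.symm.trans hp0) with h | h
      · exact hsmall 0 fun ℓ _ => h ▸ lineCount_le_left X Y ℓ
      · exact hsmall 0 fun ℓ hℓ => h ▸ lineCount_le_right X Y ℓ (hL ℓ hℓ)
    have : I = 0 := by simpa using this
    simp [this]
  have hX : 1 ≤ #X := Nat.pos_of_mul_pos_right hp0
  have hY : 1 ≤ #Y := Nat.pos_of_mul_pos_left hp0
  rcases le_or_gt (p ^ 2) l with hpl | hpl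
  · have h1 := hblocks 1 le_rfl hX hY
    have h2 : I ≤ 6 * l := by linarith
    calc I ^ 3 ≤ (6 * l) ^ 3 := Nat.pow_le_pow_left h2 3
      _ ≤ 13824 * (p ^ 2 * l ^ 2 + l ^ 3) := by
        nlinarith [Nat.zero_le (p ^ 2 * l ^ 2), Nat.zero_le (l ^ 3)]
  have hex : ∃ r, p ^ 2 < (r + 1) ^ 3 * l := by
    refine ⟨p ^ 2, ?_⟩
    calc p ^ 2 < p ^ 2 + 1 := Nat.lt_succ_self _
      _ ≤ (p ^ 2 + 1) ^ 3 := Nat.le_self_pow (by norm_num) _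
      _ ≤ (p ^ 2 + 1) ^ 3 * l := Nat.le_mul_of_pos_right _ hl0
  classical
  obtain ⟨r, hr, hmin⟩ : ∃ r, p ^ 2 < (r + 1) ^ 3 * l ∧ ∀ m < r, ¬ p ^ 2 < (m + 1) ^ 3 * l :=
    ⟨Nat.find hex, Nat.find_spec hex, fun m hm => Nat.find_min hex hm⟩
  have hr1 : 1 ≤ r := by
    rcases Nat.eq_zero_or_pos r with rfl | h
    · simp at hr; omega
    · exact h
  have hr2 : r ^ 3 * l ≤ p ^ 2 := by
    have := hmin (r - 1) (by omega)
    rw [Nat.sub_add_cancel hr1] at this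
    omega
  by_cases hrXY : r ≤ #X ∧ r ≤ #Y
  · have h1 := hblocks r hr1 hrXY.1 hrXY.2
    have h2 : r ^ 2 * I ≤ 6 * p ^ 2 := by nlinarith
    have h3 : p ^ 2 ≤ 8 * r ^ 3 * l := by
      have : (r + 1) ^ 3 ≤ (2 * r) ^ 3 := Nat.pow_le_pow_left (by omega) 3
      calc p ^ 2 ≤ (r + 1) ^ 3 * l := hr.le
        _ ≤ (2 * r) ^ 3 * l := Nat.mul_le_mul_right _ this
        _ = 8 * r ^ 3 * l := by ring
    have h4 : r ^ 6 * I ^ 3 ≤ r ^ 6 * (13824 * (p ^ 2 * l ^ 2)) := by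
      calc r ^ 6 * I ^ 3 = (r ^ 2 * I) ^ 3 := by ring
        _ ≤ (6 * p ^ 2) ^ 3 := Nat.pow_le_pow_left h2 3
        _ = 216 * p ^ 2 * (p ^ 2) ^ 2 := by ring
        _ ≤ 216 * p ^ 2 * (8 * r ^ 3 * l) ^ 2 :=
            Nat.mul_le_mul_left _ (Nat.pow_le_pow_left h3 2)
        _ = r ^ 6 * (13824 * (p ^ 2 * l ^ 2)) := by ring
    have h5 := Nat.le_of_mul_le_mul_left h4 (by positivity)
    calc I ^ 3 ≤ _ := h5
      _ ≤ _ := Nat.mul_le_mul_left _ (Nat.le_add_right _ _)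
  · have h1 : I ≤ r * l := by
      rcases not_and_or.1 hrXY with h | h
      · exact hsmall r fun ℓ _ => (lineCount_le_left X Y ℓ).trans (by omega)
      · exact hsmall r fun ℓ hℓ => (lineCount_le_right X Y ℓ (hL ℓ hℓ)).trans (by omega)
    calc I ^ 3 ≤ (r * l) ^ 3 := Nat.pow_le_pow_left h1 3
      _ = (r ^ 3 * l) * l ^ 2 := by ring
      _ ≤ p ^ 2 * l ^ 2 := Nat.mul_le_mul_right _ hr2
      _ ≤ 13824 * (p ^ 2 * l ^ 2 + l ^ 3) := by
        nlinarith [Nat.zero_le (p ^ 2 * l ^ 2), Nat.zero_le (l ^ 3)]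

lemma sum_lineCount_pow_three_le_of_card_le (X Y : Finset ℝ) (L : Finset (ℝ × ℝ))
    (hL : ∀ ℓ ∈ L, ℓ.1 ≠ 0) (hcard : #L ≤ (#X * #Y) ^ 2) :
    (∑ ℓ ∈ L, lineCount X Y ℓ) ^ 3 ≤ 27648 * ((#X * #Y) ^ 2 * #L ^ 2) := by
  have h := sum_lineCount_pow_three_le X Y L hL
  have h2 : #L ^ 3 ≤ (#X * #Y) ^ 2 * #L ^ 2 := by
    rw [pow_succ, mul_comm]
    exact Nat.mul_le_mul_right _ hcard
  omega

lemma card_mul_pow_three_le_of_rich (X Y : Finset ℝ) (L : Finset (ℝ × ℝ))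
    (hL : ∀ ℓ ∈ L, ℓ.1 ≠ 0) (hcard : #L ≤ (#X * #Y) ^ 2) (t : ℕ)
    (ht : ∀ ℓ ∈ L, t ≤ lineCount X Y ℓ) :
    #L * t ^ 3 ≤ 27648 * (#X * #Y) ^ 2 := by
  rcases Nat.eq_zero_or_pos (#L) with h0 | h0
  · simp [h0]
  have h1 : #L * t ≤ ∑ ℓ ∈ L, lineCount X Y ℓ := by
    have := card_nsmul_le_sum L (lineCount X Y) t ht
    simpa using this
  have h2 := (Nat.pow_le_pow_left h1 3).trans
    (sum_lineCount_pow_three_le_of_card_le X Y L hL hcard)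
  refine le_of_mul_le_mul_left (a := #L ^ 2) ?_ (pow_pos h0 2)
  calc #L ^ 2 * (#L * t ^ 3) = (#L * t) ^ 3 := by ring
    _ ≤ _ := h2
    _ = _ := by ring

/-- The number of lines containing at least two points of a grid is at most the number of
pairs of points. -/
lemma card_le_of_two_le_lineCount (X Y : Finset ℝ) (L : Finset (ℝ × ℝ))
    (h : ∀ ℓ ∈ L, 2 ≤ lineCount X Y ℓ) : #L ≤ (#X * #Y) ^ 2 := by
  have h1 := sum_card_pairs_le (X ×ˢ Y) L (fun _ _ => True)
  calc #L = ∑ ℓ ∈ L, 1 := by simp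
    _ ≤ _ := sum_le_sum fun ℓ hℓ => ?_
    _ ≤ _ := h1
    _ = (#X * #Y) ^ 2 := by simp [sq]
  obtain ⟨p, hp, q, hq, hpq⟩ := one_lt_card.1 (h ℓ hℓ)
  exact card_pos.2 ⟨(p, q), mem_filter.2 ⟨mem_product.2 ⟨hp, hq⟩, hpq, trivial⟩⟩

/-- The number of representations of `d` as a difference of two elements of `S`. -/
noncomputable def diffCount (S : Finset ℝ) (d : ℝ) : ℕ := #{p ∈ S ×ˢ S | p.1 - p.2 = d}

lemma card_right_le_card_mul (S B : Finset ℝ) (hS : S.Nonempty) (hS0 : (0 : ℝ) ∉ S) :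
    #B ≤ #(S * B) := by
  obtain ⟨s, hs⟩ := hS
  apply card_le_card_of_injOn (fun b => s * b)
  · intro b hb
    exact mul_mem_mul hs hb
  · intro b _ b' _ h
    exact mul_left_cancel₀ (fun h0 => hS0 (h0 ▸ hs)) h

lemma card_popular_differences (S B D : Finset ℝ) (hS0 : (0 : ℝ) ∉ S) (hB0 : (0 : ℝ) ∉ B)
    (t : ℕ) (ht1 : 1 ≤ t) (ht : ∀ d ∈ D, t ≤ diffCount S d) :
    #B * #D * t ^ 3 ≤ 27648 * (#(S * B) * #S) ^ 2 := by
  rcases D.eq_empty_or_nonempty with rfl | ⟨d₀, hd₀⟩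
  · simp
  have hSne : S.Nonempty := by
    have h1 : 0 < diffCount S d₀ := ht1.trans (ht d₀ hd₀)
    obtain ⟨p, hp⟩ := card_pos.1 h1
    simp only [mem_filter, mem_product] at hp
    exact ⟨_, hp.1.1⟩
  have hBS := card_right_le_card_mul S B hSne hS0
  have hD : #D ≤ #S * #S := by
    rw [← card_product]
    have : D ⊆ (S ×ˢ S).image (fun p => p.1 - p.2) := by
      intro d hd
      have h1 : 0 < diffCount S d := ht1.trans (ht d hd)
      obtain ⟨p, hp⟩ := card_pos.1 h1
      simp only [mem_filter] at hp
      exact mem_image.2 ⟨p, hp.1, hp.2⟩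
    exact (card_le_card this).trans card_image_le
  have hB1 : ∀ b ∈ B, b ≠ 0 := fun b hb h => hB0 (h ▸ hb)
  have hcard : #(B⁻¹ ×ˢ (-D)) = #B * #D := by
    rw [card_product, card_inv, card_neg]
  rw [← hcard]
  apply card_mul_pow_three_le_of_rich
  · intro ℓ hℓ
    obtain ⟨b, hb, hbl⟩ := mem_inv.1 (mem_product.1 hℓ).1
    rw [← hbl]
    exact inv_ne_zero (hB1 b hb)
  · rw [hcard]
    calc #B * #D ≤ #(S * B) * (#S * #S) := Nat.mul_le_mul hBS hD
      _ ≤ #(S * B) ^ 2 * (#S * #S) :=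
          Nat.mul_le_mul_right _ (Nat.le_self_pow (by norm_num) _)
      _ = _ := by ring
  · intro ℓ hℓ
    obtain ⟨b, hb, hbl⟩ := mem_inv.1 (mem_product.1 hℓ).1
    obtain ⟨d, hd, hdl⟩ := mem_neg.1 (mem_product.1 hℓ).2
    refine (ht d hd).trans ?_
    have hb0 := hB1 b hb
    apply card_le_card_of_injOn (fun p => (p.1 * b, p.2))
    · intro p hp
      simp only [coe_filter, mem_product, Set.mem_ofPred_eq] at hp ⊢
      refine ⟨⟨mul_mem_mul hp.1.1 hb, hp.1.2⟩, ?_⟩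
      rw [← hbl, ← hdl]
      field_simp
      linarith [hp.2]
    · intro p _ q _ h
      simp only [Prod.mk.injEq] at h
      exact Prod.ext (mul_right_cancel₀ hb0 h.1) h.2

lemma card_additive_triples_of_card_le (X Y Z G : Finset ℝ) (hX0 : (0 : ℝ) ∉ X)
    (hG0 : (0 : ℝ) ∉ G) (hYZ : #Y ≤ #Z) :
    #G * #{p ∈ X ×ˢ Y | p.1 + p.2 ∈ Z} ^ 3 ≤ 27648 * (#(X * G) * #Y * #Z) ^ 2 := by
  set W := #{p ∈ X ×ˢ Y | p.1 + p.2 ∈ Z} with hW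
  rcases X.eq_empty_or_nonempty with rfl | hX
  · simp [hW]
  rcases Nat.eq_zero_or_pos (#G) with hG | hG
  · simp [hG]
  have hXG := card_right_le_card_mul X G hX hX0
  have hcard : #(G⁻¹ ×ˢ Y) = #G * #Y := by rw [card_product, card_inv]
  have hG1 : ∀ b ∈ G, b ≠ 0 := fun b hb h => hG0 (h ▸ hb)
  have h1 := sum_lineCount_pow_three_le_of_card_le (X * G) Z (G⁻¹ ×ˢ Y) (by
    intro ℓ hℓ
    obtain ⟨b, hb, hbl⟩ := mem_inv.1 (mem_product.1 hℓ).1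
    rw [← hbl]
    exact inv_ne_zero (hG1 b hb)) (by
    rw [hcard]
    exact (Nat.mul_le_mul hXG hYZ).trans (Nat.le_self_pow (by norm_num) _))
  have h2 : #G * W ≤ ∑ ℓ ∈ G⁻¹ ×ˢ Y, lineCount (X * G) Z ℓ := by
    have hWs : W = ∑ y ∈ Y, #{x ∈ X | x + y ∈ Z} := by
      rw [hW, card_filter, sum_product_right]
      exact sum_congr rfl fun y _ => (card_filter _ _).symm
    rw [sum_product, ← card_inv G, hWs, ← smul_eq_mul]
    apply card_nsmul_le_sum
    intro g hg
    apply sum_le_sum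
    intro y hy
    obtain ⟨b, hb, rfl⟩ := mem_inv.1 hg
    have hb0 := hG1 b hb
    apply card_le_card_of_injOn (fun x => (x * b, x + y))
    · intro x hx
      simp only [coe_filter, mem_product, Set.mem_ofPred_eq] at hx ⊢
      refine ⟨⟨mul_mem_mul hx.1 hb, hx.2⟩, ?_⟩
      field_simp
    · intro x _ x' _ h
      simp only [Prod.mk.injEq] at h
      exact mul_right_cancel₀ hb0 h.1
  have h3 := (Nat.pow_le_pow_left h2 3).trans h1
  rw [hcard] at h3
  refine le_of_mul_le_mul_left (a := #G ^ 2) ?_ (pow_pos hG 2)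
  calc #G ^ 2 * (#G * W ^ 3) = (#G * W) ^ 3 := by ring
    _ ≤ _ := h3
    _ = _ := by ring

lemma card_additive_triples (X Y Z G : Finset ℝ) (hX0 : (0 : ℝ) ∉ X) (hG0 : (0 : ℝ) ∉ G) :
    #G * #{p ∈ X ×ˢ Y | p.1 + p.2 ∈ Z} ^ 3 ≤ 27648 * (#(X * G) * #Y * #Z) ^ 2 := by
  rcases le_total (#Y) (#Z) with h | h
  · exact card_additive_triples_of_card_le X Y Z G hX0 hG0 h
  · have h1 := card_additive_triples_of_card_le (-X) Z Y G (by simpa using hX0) hG0 h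
    have h2 : #(-X * G) = #(X * G) := by rw [neg_mul, card_neg]
    have h3 : #{p ∈ X ×ˢ Y | p.1 + p.2 ∈ Z} ≤ #{p ∈ (-X) ×ˢ Z | p.1 + p.2 ∈ Y} := by
      apply card_le_card_of_injOn (fun p => (-p.1, p.1 + p.2))
      · intro p hp
        simp only [coe_filter, mem_product, Set.mem_ofPred_eq] at hp ⊢
        exact ⟨⟨by simpa using hp.1.1, hp.2⟩, by simpa using hp.1.2⟩
      · intro p _ q _ hpq
        simp only [Prod.mk.injEq, neg_inj] at hpq
        exact Prod.ext hpq.1 (by linarith [hpq.1, hpq.2])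
    calc _ ≤ #G * #{p ∈ (-X) ×ˢ Z | p.1 + p.2 ∈ Y} ^ 3 := by gcongr
      _ ≤ _ := h1
      _ = _ := by rw [h2]; ring

/-- A cubic moment is controlled by a weak-type bound, with a logarithmic loss. -/
lemma sum_pow_three_le_of_weak {α : Type*} (L : Finset α) (f : α → ℕ) (K Q : ℕ)
    (hK : ∀ a ∈ L, f a < 2 ^ K)
    (hQ : ∀ t, 2 ≤ t → #{a ∈ L | t ≤ f a} * t ^ 3 ≤ Q) :
    ∑ a ∈ L with 2 ≤ f a, f a ^ 3 ≤ 8 * K * Q := by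
  have hpt : ∀ a ∈ L, (if 2 ≤ f a then f a ^ 3 else 0) ≤
      ∑ i ∈ Finset.range K, 8 * (if 1 ≤ i ∧ 2 ^ i ≤ f a then (2 ^ i) ^ 3 else 0) := by
    intro a ha
    split_ifs with h2
    · have h0 : f a ≠ 0 := by omega
      have hlog : Nat.log 2 (f a) < K := Nat.log_lt_of_lt_pow h0 (hK a ha)
      have hle : 2 ^ Nat.log 2 (f a) ≤ f a := Nat.pow_log_le_self 2 h0
      have hlt : f a < 2 ^ (Nat.log 2 (f a) + 1) := Nat.lt_pow_succ_log_self (by norm_num) _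
      have h1 : 1 ≤ Nat.log 2 (f a) := Nat.log_pos (by norm_num) h2
      have := single_le_sum (f := fun i => 8 * (if 1 ≤ i ∧ 2 ^ i ≤ f a then (2 ^ i) ^ 3 else 0))
        (fun i _ => Nat.zero_le _) (mem_range.2 hlog)
      rw [if_pos ⟨h1, hle⟩] at this
      calc f a ^ 3 ≤ (2 ^ (Nat.log 2 (f a) + 1)) ^ 3 := Nat.pow_le_pow_left hlt.le 3
        _ = 8 * (2 ^ Nat.log 2 (f a)) ^ 3 := by ring
        _ ≤ _ := this
    · exact Nat.zero_le _
  rw [sum_filter]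
  refine (sum_le_sum hpt).trans ?_
  rw [sum_comm]
  calc _ ≤ ∑ i ∈ Finset.range K, 8 * Q := by
        apply sum_le_sum
        intro i _
        rw [← mul_sum]
        gcongr
        by_cases hi : 1 ≤ i
        · simp only [hi, true_and]
          rw [← sum_filter, sum_const, smul_eq_mul]
          exact hQ _ (by simpa using Nat.pow_le_pow_right (n := 2) (by norm_num) hi)
        · simp [hi]
    _ = 8 * K * Q := by rw [sum_const, card_range, smul_eq_mul]; ring

lemma sq_sum_le_collisions {α β : Type*} [DecidableEq β] (T : Finset α) (f : α → β)
    (w : β → ℕ) :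
    (∑ t ∈ T, w (f t)) ^ 2 ≤
      #{p ∈ T ×ˢ T | f p.1 = f p.2} * ∑ z ∈ T.image f, w z ^ 2 := by
  have h1 : ∑ t ∈ T, w (f t) = ∑ z ∈ T.image f, #{t ∈ T | f t = z} * w z := by
    rw [← sum_fiberwise_of_maps_to (fun t ht => mem_image_of_mem f ht)]
    apply sum_congr rfl
    intro z _
    rw [sum_congr rfl (g := fun _ => w z) (fun t ht => by rw [(mem_filter.1 ht).2]), sum_const,
      smul_eq_mul]
  have h2 : #{p ∈ T ×ˢ T | f p.1 = f p.2} = ∑ z ∈ T.image f, #{t ∈ T | f t = z} ^ 2 := by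
    have hmap : ∀ p ∈ {p ∈ T ×ˢ T | f p.1 = f p.2}, f p.1 ∈ T.image f := fun p hp =>
      mem_image_of_mem f (mem_product.1 (mem_filter.1 hp).1).1
    rw [card_eq_sum_card_fiberwise hmap]
    apply sum_congr rfl
    intro z _
    rw [sq, ← card_product]
    congr 1
    ext p
    simp only [mem_filter, mem_product]
    constructor
    · rintro ⟨⟨⟨h1, h2⟩, h3⟩, h4⟩
      exact ⟨⟨h1, h4⟩, h2, h3 ▸ h4⟩
    · rintro ⟨⟨h1, h2⟩, h3, h4⟩
      exact ⟨⟨⟨h1, h3⟩, h2.trans h4.symm⟩, h2⟩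
  rw [h1, h2]
  exact sum_mul_sq_le_sq_mul_sq _ _ _

/-- The lines with slopes in `Λ` meeting the grid `A × A`, together with their reflections. -/
noncomputable def gridLines (A Λ : Finset ℝ) : Finset (ℝ × ℝ) :=
  Λ ×ˢ ((A - Λ * A) ∪ -(A - Λ * A))

lemma sum_gridLines_reflect (A Λ : Finset ℝ) (g : ℝ × ℝ → ℕ) :
    ∑ ℓ ∈ gridLines A Λ, g (ℓ.1, -ℓ.2) = ∑ ℓ ∈ gridLines A Λ, g ℓ := by
  have hmaps : ∀ ℓ ∈ gridLines A Λ, (ℓ.1, -ℓ.2) ∈ gridLines A Λ := by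
    intro ℓ hℓ
    simp only [gridLines, mem_product, mem_union, mem_neg', neg_neg] at hℓ ⊢
    tauto
  exact sum_nbij' (fun ℓ => (ℓ.1, -ℓ.2)) (fun ℓ => (ℓ.1, -ℓ.2)) hmaps hmaps
    (by simp) (by simp) (by simp)

lemma card_gridLines_hit_le (A Λ : Finset ℝ) :
    #{ℓ ∈ gridLines A Λ | 1 ≤ lineCount A A ℓ} ≤ #Λ * #A ^ 2 := by
  have : {ℓ ∈ gridLines A Λ | 1 ≤ lineCount A A ℓ} ⊆
      (Λ ×ˢ (A ×ˢ A)).image (fun p => (p.1, p.2.2 - p.1 * p.2.1)) := by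
    intro ℓ hℓ
    rw [mem_filter] at hℓ
    obtain ⟨p, hp⟩ := card_pos.1 hℓ.2
    rw [mem_filter] at hp
    refine mem_image.2 ⟨(ℓ.1, p), mem_product.2 ⟨(mem_product.1 hℓ.1).1, hp.1⟩, ?_⟩
    exact Prod.ext rfl (by simp [hp.2])
  calc _ ≤ _ := card_le_card this
    _ ≤ _ := card_image_le
    _ = _ := by simp [card_product, sq]

lemma sum_gridLines_pow_three_le (A Λ : Finset ℝ) (hΛ : (0 : ℝ) ∉ Λ) (K : ℕ)
    (hK : #A < 2 ^ K) :
    ∑ ℓ ∈ gridLines A Λ with 2 ≤ lineCount A A ℓ, lineCount A A ℓ ^ 3 ≤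
      8 * K * (27648 * #A ^ 4) := by
  apply sum_pow_three_le_of_weak
  · exact fun ℓ _ => (lineCount_le_left A A ℓ).trans_lt hK
  · intro t ht
    refine (card_mul_pow_three_le_of_rich A A _ ?_ ?_ t fun ℓ hℓ => (mem_filter.1 hℓ).2).trans
      (le_of_eq (by ring))
    · intro ℓ hℓ h0
      exact hΛ (h0 ▸ (mem_product.1 (mem_filter.1 hℓ).1).1)
    · exact card_le_of_two_le_lineCount A A _ fun ℓ hℓ => ht.trans (mem_filter.1 hℓ).2

lemma sum_gridLines_pow_four_le (A Λ : Finset ℝ) (hΛ : (0 : ℝ) ∉ Λ) (K : ℕ)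
    (hK : #A < 2 ^ K) :
    ∑ ℓ ∈ gridLines A Λ, lineCount A A ℓ ^ 4 ≤
      #Λ * #A ^ 2 + 221184 * K * #A ^ 5 := by
  have hpt : ∀ ℓ ∈ gridLines A Λ, lineCount A A ℓ ^ 4 ≤ (if 1 ≤ lineCount A A ℓ then 1 else 0) +
      #A * (if 2 ≤ lineCount A A ℓ then lineCount A A ℓ ^ 3 else 0) := by
    intro ℓ _
    have := lineCount_le_left A A ℓ
    rcases Nat.lt_or_ge (lineCount A A ℓ) 2 with h | h
    · interval_cases lineCount A A ℓ <;> simp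
    · rw [if_pos h, pow_succ, mul_comm]
      exact (Nat.mul_le_mul_right _ this).trans (Nat.le_add_left _ _)
  refine (sum_le_sum hpt).trans ?_
  rw [sum_add_distrib, ← card_filter, ← mul_sum, ← sum_filter]
  calc _ ≤ #Λ * #A ^ 2 + #A * (8 * K * (27648 * #A ^ 4)) :=
        Nat.add_le_add (card_gridLines_hit_le A Λ)
          (Nat.mul_le_mul_left _ (sum_gridLines_pow_three_le A Λ hΛ K hK))
    _ = _ := by ring

lemma zero_notMem_div_self (S : Finset ℝ) (hS : (0 : ℝ) ∉ S) : (0 : ℝ) ∉ S / S := by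
  intro h
  obtain ⟨a, ha, b, hb, hab⟩ := mem_div.1 h
  rcases div_eq_zero_iff.1 hab with h | h
  · exact hS (h ▸ ha)
  · exact hS (h ▸ hb)

/-- The ratios of sums of `A` are nearly quadratically many. -/
lemma sq_card_le_card_ratios (A : Finset ℝ) (hA : A.Nonempty) (hS : (0 : ℝ) ∉ A + A) (K : ℕ)
    (hK : #A < 2 ^ K) :
    #A ^ 2 ≤ 16 * (221184 * K) ^ 2 * #((A + A) / (A + A)) := by
  set Λ := (A + A) / (A + A) with hΛdef
  have hΛ : (0 : ℝ) ∉ Λ := zero_notMem_div_self _ hS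
  have hN : 0 < #A := card_pos.2 hA
  have hK1 : 1 ≤ K := by
    rcases Nat.eq_zero_or_pos K with rfl | h
    · simp at hK; simp [hK] at hN
    · exact h
  set m := lineCount A A with hm
  have h1 : #A ^ 4 ≤ ∑ ℓ ∈ gridLines A Λ, m ℓ * m (ℓ.1, -ℓ.2) := by
    have hc : #A ^ 4 = #((A ×ˢ A) ×ˢ (A ×ˢ A)) := by simp only [card_product]; ring
    simp only [hm, lineCount, ← card_product]
    rw [hc, ← card_sigma]
    apply card_le_card_of_injOn (fun q => (⟨((q.1.2 + q.2.2) / (q.1.1 + q.2.1),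
      q.1.2 - (q.1.2 + q.2.2) / (q.1.1 + q.2.1) * q.1.1), q⟩ :
        Sigma fun _ : ℝ × ℝ => (ℝ × ℝ) × (ℝ × ℝ)))
    · rintro ⟨⟨c, a⟩, ⟨d, b⟩⟩ hq
      simp only [coe_product, Set.mem_prod, mem_coe] at hq
      obtain ⟨⟨hc, ha⟩, hd, hb⟩ := hq
      have hcd : c + d ≠ 0 := fun h => hS (h ▸ add_mem_add hc hd)
      have hl : (a + b) / (c + d) ∈ Λ := div_mem_div (add_mem_add ha hb) (add_mem_add hc hd)
      simp only [coe_sigma, Set.mem_sigma_iff, mem_coe, mem_product, mem_filter, gridLines,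
        mem_union]
      refine ⟨⟨hl, Or.inl (sub_mem_sub ha (mul_mem_mul hl hc))⟩, ⟨⟨hc, ha⟩, by ring⟩,
        ⟨hd, hb⟩, ?_⟩
      field_simp
      ring
    · intro q _ q' _ h
      simpa using congrArg (fun z => z.2) h
  have h2 : ∑ ℓ ∈ gridLines A Λ, m ℓ * m (ℓ.1, -ℓ.2) ≤ ∑ ℓ ∈ gridLines A Λ, m ℓ ^ 2 := by
    have h3 : 2 * ∑ ℓ ∈ gridLines A Λ, m ℓ * m (ℓ.1, -ℓ.2) ≤
        ∑ ℓ ∈ gridLines A Λ, (m ℓ ^ 2 + m (ℓ.1, -ℓ.2) ^ 2) := by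
      rw [mul_sum]
      apply sum_le_sum
      intro ℓ _
      have := two_mul_le_add_sq (m ℓ) (m (ℓ.1, -ℓ.2))
      linarith
    rw [sum_add_distrib, sum_gridLines_reflect A Λ (fun ℓ => m ℓ ^ 2)] at h3
    omega
  set c := 221184 * K with hcdef
  have h4 : (2 * c) * ∑ ℓ ∈ gridLines A Λ, m ℓ ^ 2 ≤
      (2 * c) ^ 3 * (#Λ * #A ^ 2) + c * #A ^ 4 := by
    have hpt : ∀ ℓ ∈ gridLines A Λ, (2 * c) * m ℓ ^ 2 ≤
        (2 * c) ^ 3 * (if 1 ≤ m ℓ then 1 else 0) + (if 2 ≤ m ℓ then m ℓ ^ 3 else 0) := by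
      intro ℓ _
      have hc1 : 1 ≤ 2 * c := by omega
      rcases Nat.eq_zero_or_pos (m ℓ) with h | h
      · simp [h]
      · rw [if_pos (show 1 ≤ m ℓ from h)]
        rcases le_or_gt (m ℓ) (2 * c) with h' | h'
        · calc (2 * c) * m ℓ ^ 2 ≤ (2 * c) * (2 * c) ^ 2 := by gcongr
            _ = (2 * c) ^ 3 * 1 := by ring
            _ ≤ _ := Nat.le_add_right _ _
        · rw [if_pos (by omega)]
          calc (2 * c) * m ℓ ^ 2 ≤ m ℓ * m ℓ ^ 2 := by gcongr
            _ = m ℓ ^ 3 := by ring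
            _ ≤ _ := Nat.le_add_left _ _
    rw [mul_sum]
    refine (sum_le_sum hpt).trans ?_
    rw [sum_add_distrib, ← mul_sum, ← card_filter, ← sum_filter]
    refine Nat.add_le_add (Nat.mul_le_mul_left _ (card_gridLines_hit_le A Λ)) ?_
    refine (sum_gridLines_pow_three_le A Λ hΛ K hK).trans (le_of_eq ?_)
    rw [hcdef]; ring
  have h5 : (2 * c) * #A ^ 4 ≤ (2 * c) ^ 3 * (#Λ * #A ^ 2) + c * #A ^ 4 :=
    (Nat.mul_le_mul_left _ (h1.trans h2)).trans h4
  have h6 : (c * #A ^ 2) * #A ^ 2 ≤ (c * #A ^ 2) * (16 * c ^ 2 * #Λ) := by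
    nlinarith [Nat.zero_le (c ^ 3 * (#Λ * #A ^ 2))]
  exact le_of_mul_le_mul_left h6 (by positivity)

/-- The additive energy of a finite set of reals. -/
noncomputable def additiveEnergy (S : Finset ℝ) : ℕ := ∑ d ∈ S - S, diffCount S d ^ 2

/-- Dilates of the additive parallelograms in `A + A` produce additive energy. -/
lemma card_mul_le_additiveEnergy (A X : Finset ℝ) (hA : A.Nonempty) (hXne : X.Nonempty)
    (hS : (0 : ℝ) ∉ A + A) (hX : (0 : ℝ) ∉ X) (K : ℕ) (hK : #A < 2 ^ K)
    (hΛ : #((A + A) / (A + A)) ≤ #A ^ 3) :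
    #A ^ 3 * #X ≤ 442368 * K * additiveEnergy ((A + A) * X) := by
  set Λ := (A + A) / (A + A) with hΛdef
  set m := lineCount A A with hm
  have hΛ0 : (0 : ℝ) ∉ Λ := zero_notMem_div_self _ hS
  have hN : 0 < #A := card_pos.2 hA
  have hK1 : 1 ≤ K := by
    rcases Nat.eq_zero_or_pos K with rfl | h
    · simp at hK; simp [hK] at hN
    · exact h
  set T := ((A ×ˢ A) ×ˢ (A ×ˢ A)) ×ˢ X with hT
  set f : ((ℝ × ℝ) × (ℝ × ℝ)) × ℝ → (ℝ × ℝ) × (ℝ × ℝ) := fun t =>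
    (((t.1.1.1 + t.1.2.1) * t.2, (t.1.1.2 + t.1.2.1) * t.2),
      ((t.1.1.1 + t.1.2.2) * t.2, (t.1.1.2 + t.1.2.2) * t.2)) with hf
  have hcs := sq_sum_le_collisions T f (fun _ => 1)
  have hTcard : ∑ t ∈ T, 1 = #A ^ 4 * #X := by
    simp only [sum_const, smul_eq_mul, mul_one, hT, card_product]; ring
  have himage : ∑ z ∈ T.image f, 1 ^ 2 ≤ additiveEnergy ((A + A) * X) := by
    simp only [one_pow, sum_const, smul_eq_mul, mul_one, additiveEnergy, diffCount]
    simp only [sq, ← card_product]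
    rw [← card_sigma]
    apply card_le_card_of_injOn (fun z => (⟨z.1.1 - z.1.2, z⟩ :
        Sigma fun _ : ℝ => (ℝ × ℝ) × (ℝ × ℝ)))
    · intro z hz
      simp only [coe_image, Set.mem_image, mem_coe] at hz
      obtain ⟨⟨⟨⟨a, a'⟩, ⟨b, b'⟩⟩, x⟩, ht, rfl⟩ := hz
      simp only [hT, mem_product] at ht
      obtain ⟨⟨⟨ha, ha'⟩, hb, hb'⟩, hx⟩ := ht
      have m1 := mul_mem_mul (add_mem_add ha hb) hx
      have m2 := mul_mem_mul (add_mem_add ha' hb) hx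
      have m3 := mul_mem_mul (add_mem_add ha hb') hx
      have m4 := mul_mem_mul (add_mem_add ha' hb') hx
      simp only [hf, coe_sigma, Set.mem_sigma_iff, mem_coe, mem_product, mem_filter]
      exact ⟨sub_mem_sub m1 m2, ⟨⟨m1, m2⟩, trivial⟩, ⟨m3, m4⟩, by ring⟩
    · intro q _ q' _ h
      simpa using congrArg (fun z => z.2) h
  have hcoll : #{p ∈ T ×ˢ T | f p.1 = f p.2} ≤
      #X * ∑ ℓ ∈ gridLines A Λ, (m ℓ * m ℓ) * (m (ℓ.1, -ℓ.2) * m (ℓ.1, -ℓ.2)) := by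
    simp only [hm, lineCount, ← card_product]
    rw [← card_sigma, ← card_product]
    apply card_le_card_of_injOn (fun p => (p.1.2,
      (⟨(p.2.2 / p.1.2, p.1.1.1.1 - p.2.2 / p.1.2 * p.2.1.1.1),
        (((p.2.1.1.1, p.1.1.1.1), (p.2.1.1.2, p.1.1.1.2)),
          ((p.2.1.2.1, p.1.1.2.1), (p.2.1.2.2, p.1.1.2.2)))⟩ :
        Sigma fun _ : ℝ × ℝ => ((ℝ × ℝ) × (ℝ × ℝ)) × ((ℝ × ℝ) × (ℝ × ℝ)))))
    · rintro ⟨⟨⟨⟨a, a'⟩, ⟨b, b'⟩⟩, x⟩, ⟨⟨⟨c, c'⟩, ⟨d, d'⟩⟩, y⟩⟩ hp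
      simp only [coe_filter, hT, mem_product, Set.mem_ofPred_eq, hf, Prod.mk.injEq] at hp
      obtain ⟨⟨⟨⟨⟨ha, ha'⟩, hb, hb'⟩, hx⟩, ⟨⟨hc, hc'⟩, hd, hd'⟩, hy⟩, ⟨e1, e2⟩, e3, e4⟩ := hp
      have hx0 : x ≠ 0 := fun h => hX (h ▸ hx)
      have hcd : c + d ≠ 0 := fun h => hS (h ▸ add_mem_add hc hd)
      have hyx : y / x = (a + b) / (c + d) := by
        rw [div_eq_div_iff hx0 hcd]; linarith
      have hl : y / x ∈ Λ := hyx ▸ div_mem_div (add_mem_add ha hb) (add_mem_add hc hd)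
      have E : ∀ s t : ℝ, s * x = t * y → s = y / x * t := by
        intro s t h
        field_simp
        linarith
      have E1 := E _ _ e1
      have E2 := E _ _ e2
      have E3 := E _ _ e3
      simp only [coe_product, Set.mem_prod, coe_sigma, Set.mem_sigma_iff, mem_coe, mem_product,
        mem_filter, gridLines, mem_union]
      refine ⟨hx, ⟨hl, Or.inl (sub_mem_sub ha (mul_mem_mul hl hc))⟩,
        ⟨⟨⟨hc, ha⟩, ?_⟩, ⟨hc', ha'⟩, ?_⟩, ⟨⟨hd, hb⟩, ?_⟩, ⟨hd', hb'⟩, ?_⟩ <;> linarith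
    · rintro ⟨⟨⟨⟨a, a'⟩, ⟨b, b'⟩⟩, x⟩, ⟨⟨⟨c, c'⟩, ⟨d, d'⟩⟩, y⟩⟩ hp
        ⟨⟨⟨⟨a2, a2'⟩, ⟨b2, b2'⟩⟩, x2⟩, ⟨⟨⟨c2, c2'⟩, ⟨d2, d2'⟩⟩, y2⟩⟩ hp2 h
      have h1 := congrArg (fun z => z.1) h
      have h2 := congrArg (fun z => z.2.1.1) h
      have h3 := congrArg (fun z => z.2.2) h
      simp only [Prod.mk.injEq] at h1 h2 h3
      subst h1
      have hx0 : x ≠ 0 := fun h => hX (by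
        simp only [coe_filter, hT, mem_product, Set.mem_ofPred_eq] at hp
        exact h ▸ hp.1.1.2)
      have hy : y = y2 := by
        field_simp at h2
        exact h2
      simp only [Prod.mk.injEq]
      tauto
  have hmoment : ∑ ℓ ∈ gridLines A Λ, (m ℓ * m ℓ) * (m (ℓ.1, -ℓ.2) * m (ℓ.1, -ℓ.2)) ≤
      ∑ ℓ ∈ gridLines A Λ, m ℓ ^ 4 := by
    have h3 : 2 * ∑ ℓ ∈ gridLines A Λ, (m ℓ * m ℓ) * (m (ℓ.1, -ℓ.2) * m (ℓ.1, -ℓ.2)) ≤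
        ∑ ℓ ∈ gridLines A Λ, (m ℓ ^ 4 + m (ℓ.1, -ℓ.2) ^ 4) := by
      rw [mul_sum]
      apply sum_le_sum
      intro ℓ _
      have := two_mul_le_add_sq (m ℓ * m ℓ) (m (ℓ.1, -ℓ.2) * m (ℓ.1, -ℓ.2))
      calc _ = 2 * (m ℓ * m ℓ) * (m (ℓ.1, -ℓ.2) * m (ℓ.1, -ℓ.2)) := by ring
        _ ≤ _ := this
        _ = _ := by ring
    rw [sum_add_distrib, sum_gridLines_reflect A Λ (fun ℓ => m ℓ ^ 4)] at h3
    omega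
  have hfour : ∑ ℓ ∈ gridLines A Λ, m ℓ ^ 4 ≤ 442368 * K * #A ^ 5 := by
    refine (sum_gridLines_pow_four_le A Λ hΛ0 K hK).trans ?_
    have h1 : #Λ * #A ^ 2 ≤ #A ^ 5 := by
      calc #Λ * #A ^ 2 ≤ #A ^ 3 * #A ^ 2 := Nat.mul_le_mul_right _ hΛ
        _ = #A ^ 5 := by ring
    have h2 : #A ^ 5 ≤ K * #A ^ 5 := Nat.le_mul_of_pos_left _ hK1
    nlinarith
  rw [hTcard] at hcs
  have hXpos : 0 < #X := card_pos.2 hXne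
  refine le_of_mul_le_mul_left (a := #A ^ 5 * #X) ?_ (by positivity)
  calc #A ^ 5 * #X * (#A ^ 3 * #X) = (#A ^ 4 * #X) ^ 2 := by ring
    _ ≤ _ := hcs
    _ ≤ (#X * (442368 * K * #A ^ 5)) * additiveEnergy ((A + A) * X) :=
        Nat.mul_le_mul (hcoll.trans (Nat.mul_le_mul_left _ (hmoment.trans hfour))) himage
    _ = _ := by ring

/-- For a Gram matrix `T = C Cᵀ` of size `n`, `(∑ T)³ ≤ n³ tr T³`. -/
lemma sum_gram_pow_three_le {α β : Type*} (I : Finset α) (J : Finset β) (C : α → β → ℕ) :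
    (∑ x ∈ J, (∑ a ∈ I, C a x) ^ 2) ^ 3 ≤ #I ^ 3 * ∑ b ∈ I, ∑ a ∈ I, ∑ a' ∈ I,
      (∑ x ∈ J, C a x * C b x) * (∑ x ∈ J, C a' x * C b x) * (∑ x ∈ J, C a x * C a' x) := by
  set T : α → α → ℕ := fun a b => ∑ x ∈ J, C a x * C b x with hT
  set v : β → ℕ := fun x => ∑ a ∈ I, C a x with hv
  set u : α → ℕ := fun a => ∑ x ∈ J, C a x * v x with hu
  set w : β → ℕ := fun x => ∑ a ∈ I, C a x * u a with hw
  set E := ∑ x ∈ J, v x ^ 2 with hE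
  set P := ∑ a ∈ I, u a ^ 2 with hP
  set R := ∑ x ∈ J, w x ^ 2 with hR
  have huT : ∀ a, u a = ∑ b ∈ I, T a b := by
    intro a
    simp only [hu, hT, hv, mul_sum]
    exact sum_comm
  have hEu : E = ∑ a ∈ I, u a := by
    simp only [hE, hu, hv]
    rw [sum_comm]
    exact sum_congr rfl fun x _ => by rw [← sum_mul, sq]
  have hPw : P = ∑ x ∈ J, v x * w x := by
    have : P = ∑ a ∈ I, ∑ x ∈ J, C a x * v x * u a :=
      sum_congr rfl fun a _ => by rw [sq, ← sum_mul]
    rw [this, sum_comm]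
    exact sum_congr rfl fun x _ => by
      simp only [hw, mul_sum]
      exact sum_congr rfl fun a _ => by ring
  have h1 : E ^ 2 ≤ #I * P := by
    rw [hEu]
    exact sq_sum_le_card_mul_sum_sq
  have h2 : P ^ 2 ≤ E * R := by
    rw [hPw]
    exact sum_mul_sq_le_sq_mul_sq _ _ _
  set Q := ∑ b ∈ I, ∑ a ∈ I, ∑ a' ∈ I, T a b * T a' b * T a a' with hQ
  have hwM : ∀ x, w x = ∑ b ∈ I, ∑ a ∈ I, C a x * T a b := by
    intro x
    rw [sum_comm]
    exact sum_congr rfl fun a _ => by rw [huT, mul_sum]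
  have hQM : Q = ∑ x ∈ J, ∑ b ∈ I, (∑ a ∈ I, C a x * T a b) ^ 2 := by
    rw [sum_comm]
    apply sum_congr rfl
    intro b _
    have h : ∀ x ∈ J, (∑ a ∈ I, C a x * T a b) ^ 2 =
        ∑ a ∈ I, ∑ a' ∈ I, (C a x * T a b) * (C a' x * T a' b) := fun x _ => by
      rw [sq, sum_mul_sum]
    rw [sum_congr rfl h]
    refine Eq.trans ?_ sum_comm
    apply sum_congr rfl
    intro a _
    refine Eq.trans ?_ sum_comm
    apply sum_congr rfl
    intro a' _
    simp only [hT]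
    rw [mul_sum]
    exact sum_congr rfl fun x _ => by ring
  have h3 : R ≤ #I * Q := by
    rw [hQM, mul_sum]
    apply sum_le_sum
    intro x _
    rw [hwM]
    exact sq_sum_le_card_mul_sum_sq
  rcases Nat.eq_zero_or_pos E with h0 | h0
  · simp [h0]
  refine le_of_mul_le_mul_left (a := E) ?_ h0
  calc E * E ^ 3 = (E ^ 2) ^ 2 := by ring
    _ ≤ (#I * P) ^ 2 := Nat.pow_le_pow_left h1 2
    _ = #I ^ 2 * P ^ 2 := by ring
    _ ≤ #I ^ 2 * (E * (#I * Q)) := by gcongr; exact h2.trans (by gcongr)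
    _ = E * (#I ^ 3 * Q) := by ring

lemma diffCount_neg (S : Finset ℝ) (d : ℝ) : diffCount S (-d) = diffCount S d := by
  apply card_nbij' Prod.swap Prod.swap
  · intro p hp
    simp only [coe_filter, mem_product, Set.mem_ofPred_eq, Prod.fst_swap, Prod.snd_swap] at hp ⊢
    exact ⟨hp.1.symm, by linarith [hp.2]⟩
  · intro p hp
    simp only [coe_filter, mem_product, Set.mem_ofPred_eq, Prod.fst_swap, Prod.snd_swap] at hp ⊢
    exact ⟨hp.1.symm, by linarith [hp.2]⟩
  · exact fun p _ => Prod.swap_swap p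
  · exact fun p _ => Prod.swap_swap p

lemma diffCount_eq_sum (S : Finset ℝ) (x : ℝ) :
    diffCount S x = ∑ a ∈ S, if a - x ∈ S then 1 else 0 := by
  rw [← card_filter]
  apply card_nbij' (fun p => p.1) (fun a => (a, a - x))
  · intro p hp
    simp only [coe_filter, mem_product, Set.mem_ofPred_eq] at hp ⊢
    refine ⟨hp.1.1, ?_⟩
    rw [← hp.2, sub_sub_cancel]
    exact hp.1.2
  · intro a ha
    simp only [coe_filter, mem_product, Set.mem_ofPred_eq] at ha ⊢
    exact ⟨ha, by ring⟩
  · intro p hp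
    simp only [coe_filter, mem_product, Set.mem_ofPred_eq] at hp
    exact Prod.ext rfl (by simp [← hp.2])
  · intro a _
    rfl

lemma diffCount_sub_eq_sum (S : Finset ℝ) {a b : ℝ} (ha : a ∈ S) :
    diffCount S (a - b) =
      ∑ x ∈ S - S, (if a - x ∈ S then 1 else 0) * (if b - x ∈ S then 1 else 0) := by
  simp only [← ite_and, mul_ite, mul_one, mul_zero]
  rw [← card_filter]
  apply card_nbij' (fun p => a - p.1) (fun x => (a - x, b - x))
  · intro p hp
    simp only [coe_filter, mem_product, Set.mem_ofPred_eq] at hp ⊢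
    refine ⟨sub_mem_sub ha hp.1.1, ?_, ?_⟩
    · rw [show b - (a - p.1) = p.2 by linarith [hp.2]]
      exact hp.1.2
    · rw [sub_sub_cancel]
      exact hp.1.1
  · intro x hx
    simp only [coe_filter, mem_product, Set.mem_ofPred_eq] at hx ⊢
    exact ⟨⟨hx.2.2, hx.2.1⟩, by ring⟩
  · intro p hp
    simp only [coe_filter, mem_product, Set.mem_ofPred_eq] at hp
    exact Prod.ext (by simp) (by simp only; linarith [hp.2])
  · intro x _
    simp

/-- Triples of elements of `S` weighted by the popularity of all three differences. -/
lemma additiveEnergy_pow_three_le (S : Finset ℝ) :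
    additiveEnergy S ^ 3 ≤ #S ^ 3 * ∑ t ∈ (S ×ˢ S) ×ˢ S,
      diffCount S (t.1.1 - t.1.2) * diffCount S (t.1.2 - t.2) * diffCount S (t.1.1 - t.2) := by
  have h := sum_gram_pow_three_le S (S - S) (fun a x => if a - x ∈ S then 1 else 0)
  simp only [← diffCount_eq_sum] at h
  refine h.trans (le_of_eq ?_)
  congr 1
  rw [sum_product, sum_product, sum_comm]
  apply sum_congr rfl
  intro a ha
  apply sum_congr rfl
  intro b hb
  apply sum_congr rfl
  intro c hc
  rw [← diffCount_sub_eq_sum S ha, ← diffCount_sub_eq_sum S hc, ← diffCount_sub_eq_sum S ha,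
    ← diffCount_neg S (c - b), neg_sub]

lemma sum_diffCount_sq_eq (S : Finset ℝ) :
    ∑ p ∈ S ×ˢ S, diffCount S (p.1 - p.2) ^ 2 = ∑ d ∈ S - S, diffCount S d ^ 3 := by
  have hmap : ∀ p ∈ S ×ˢ S, p.1 - p.2 ∈ S - S := fun p hp =>
    sub_mem_sub (mem_product.1 hp).1 (mem_product.1 hp).2
  rw [← sum_fiberwise_of_maps_to hmap]
  apply sum_congr rfl
  intro d _
  rw [sum_congr rfl (g := fun _ => diffCount S d ^ 2)
    (fun p hp => by rw [(mem_filter.1 hp).2]), sum_const, smul_eq_mul]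
  change diffCount S d * diffCount S d ^ 2 = _
  ring

lemma diffCount_le_card (S : Finset ℝ) (d : ℝ) : diffCount S d ≤ #S := by
  rw [diffCount_eq_sum, ← card_filter]
  exact card_filter_le _ _

lemma sum_triples_diag_le (S : Finset ℝ) :
    ∑ t ∈ (S ×ˢ S) ×ˢ S with t.1.1 = t.1.2,
      diffCount S (t.1.1 - t.1.2) * diffCount S (t.1.2 - t.2) * diffCount S (t.1.1 - t.2) ≤
      #S * ∑ d ∈ S - S, diffCount S d ^ 3 := by
  rw [← sum_diffCount_sq_eq, mul_sum]
  have : ∑ p ∈ S ×ˢ S, #S * diffCount S (p.1 - p.2) ^ 2 =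
      ∑ t ∈ (S ×ˢ S) ×ˢ S with t.1.1 = t.1.2, #S * diffCount S (t.1.1 - t.2) ^ 2 := by
    apply sum_nbij' (fun p => ((p.1, p.1), p.2)) (fun t => (t.1.1, t.2))
    · intro p hp
      simp only [mem_filter, mem_product] at hp ⊢
      exact ⟨⟨⟨hp.1, hp.1⟩, hp.2⟩, trivial⟩
    · intro t ht
      simp only [mem_filter, mem_product] at ht ⊢
      exact ⟨ht.1.1.1, ht.1.2⟩
    · simp
    · intro t ht
      simp only [mem_filter] at ht
      simp [ht.2, Prod.ext_iff]
    · simp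
  rw [this]
  apply sum_le_sum
  intro t ht
  rw [← (mem_filter.1 ht).2, mul_assoc, ← sq]
  exact Nat.mul_le_mul_right _ (diffCount_le_card S _)

lemma sum_triples_offDiag_sq_le (S : Finset ℝ) :
    (∑ t ∈ (S ×ˢ S) ×ˢ S with t.1.1 ≠ t.1.2,
      diffCount S (t.1.1 - t.1.2) * diffCount S (t.1.2 - t.2) * diffCount S (t.1.1 - t.2)) ^ 2 ≤
      (∑ d ∈ S - S, diffCount S d ^ 3) *
        ∑ z ∈ (S - S).erase 0 ×ˢ (S - S) with z.1 + z.2 ∈ S - S,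
          diffCount S z.1 ^ 2 * diffCount S z.2 ^ 2 * diffCount S (z.1 + z.2) ^ 2 := by
  set T := {t ∈ (S ×ˢ S) ×ˢ S | t.1.1 ≠ t.1.2} with hT
  set f : (ℝ × ℝ) × ℝ → ℝ × ℝ := fun t => (t.1.1 - t.1.2, t.1.2 - t.2) with hf
  set w : ℝ × ℝ → ℕ := fun z => diffCount S z.1 * diffCount S z.2 * diffCount S (z.1 + z.2)
    with hw
  have h := sq_sum_le_collisions T f w
  have hsum : ∑ t ∈ T, w (f t) = ∑ t ∈ T,
      diffCount S (t.1.1 - t.1.2) * diffCount S (t.1.2 - t.2) * diffCount S (t.1.1 - t.2) :=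
    sum_congr rfl fun t _ => by simp [hw, hf]
  rw [hsum] at h
  refine h.trans (Nat.mul_le_mul ?_ ?_)
  · simp only [pow_succ, pow_zero, one_mul, diffCount, ← card_product]
    rw [← card_sigma]
    apply card_le_card_of_injOn (fun p => (⟨p.1.1.1 - p.2.1.1,
      (((p.1.1.1, p.2.1.1), (p.1.1.2, p.2.1.2)), (p.1.2, p.2.2))⟩ :
        Sigma fun _ : ℝ => ((ℝ × ℝ) × (ℝ × ℝ)) × (ℝ × ℝ)))
    · rintro ⟨⟨⟨a, b⟩, c⟩, ⟨⟨a', b'⟩, c'⟩⟩ hp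
      simp only [hT, hf, coe_filter, mem_product, mem_filter, Set.mem_ofPred_eq,
        Prod.mk.injEq] at hp
      obtain ⟨⟨⟨⟨⟨ha, hb⟩, hc⟩, -⟩, ⟨⟨ha', hb'⟩, hc'⟩, -⟩, e1, e2⟩ := hp
      simp only [coe_sigma, Set.mem_sigma_iff, mem_coe, mem_product, mem_filter]
      exact ⟨sub_mem_sub ha ha', ⟨⟨⟨ha, ha'⟩, trivial⟩, ⟨hb, hb'⟩, by linarith⟩,
        ⟨hc, hc'⟩, by linarith⟩
    · rintro ⟨⟨⟨a, b⟩, c⟩, ⟨⟨a', b'⟩, c'⟩⟩ - ⟨⟨⟨a2, b2⟩, c2⟩, ⟨⟨a2', b2'⟩, c2'⟩⟩ - h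
      have h3 := congrArg (fun z => z.2) h
      simp only [Prod.mk.injEq] at h3 ⊢
      tauto
  · rw [sum_congr rfl (g := fun z : ℝ × ℝ => diffCount S z.1 ^ 2 * diffCount S z.2 ^ 2 *
      diffCount S (z.1 + z.2) ^ 2) (fun z _ => by simp only [hw]; ring)]
    apply sum_le_sum_of_subset
    intro z hz
    obtain ⟨⟨⟨a, b⟩, c⟩, ht, rfl⟩ := mem_image.1 hz
    simp only [hT, mem_filter, mem_product] at ht
    obtain ⟨⟨⟨ha, hb⟩, hc⟩, hab⟩ := ht
    simp only [hf, mem_filter, mem_product, mem_erase, sub_add_sub_cancel]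
    exact ⟨⟨⟨sub_ne_zero.2 hab, sub_mem_sub ha hb⟩, sub_mem_sub hb hc⟩, sub_mem_sub ha hc⟩

lemma sq_le_sum_dyadic (n K : ℕ) (h : n < 2 ^ K) :
    n ^ 2 ≤ ∑ i ∈ Finset.range K, 4 ^ (i + 1) * (if 2 ^ i ≤ n then 1 else 0) := by
  rcases Nat.eq_zero_or_pos n with rfl | hn
  · simp
  have h0 : n ≠ 0 := hn.ne'
  have hlog : Nat.log 2 n < K := Nat.log_lt_of_lt_pow h0 h
  have hle : 2 ^ Nat.log 2 n ≤ n := Nat.pow_log_le_self 2 h0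
  have hlt : n < 2 ^ (Nat.log 2 n + 1) := Nat.lt_pow_succ_log_self (by norm_num) _
  have := single_le_sum (f := fun i => 4 ^ (i + 1) * (if 2 ^ i ≤ n then 1 else 0))
    (fun i _ => Nat.zero_le _) (mem_range.2 hlog)
  rw [if_pos hle] at this
  calc n ^ 2 ≤ (2 ^ (Nat.log 2 n + 1)) ^ 2 := Nat.pow_le_pow_left hlt.le 2
    _ = 4 ^ (Nat.log 2 n + 1) * 1 := by rw [← pow_mul, mul_comm, pow_mul]; norm_num
    _ ≤ _ := this

/-- The differences of `S` with at least `t` representations. -/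
noncomputable def popularDifferences (S : Finset ℝ) (t : ℕ) : Finset ℝ :=
  {d ∈ S - S | t ≤ diffCount S d}

lemma card_popularDifferences_mul_le (S : Finset ℝ) (hS0 : (0 : ℝ) ∉ S) (M : ℕ) (hSM : #S ≤ M)
    (hM : #(S * S⁻¹) ≤ M) (t : ℕ) (ht : 1 ≤ t) :
    #(popularDifferences S t) * t ^ 3 ≤ 27648 * M ^ 3 := by
  rcases S.eq_empty_or_nonempty with rfl | hS
  · simp [popularDifferences]
  have h := card_popular_differences S S⁻¹ (popularDifferences S t) hS0 (by simpa using hS0) t ht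
    fun d hd => (mem_filter.1 hd).2
  rw [card_inv] at h
  refine le_of_mul_le_mul_left (a := #S) ?_ (card_pos.2 hS)
  calc #S * (#(popularDifferences S t) * t ^ 3) = #S * #(popularDifferences S t) * t ^ 3 := by ring
    _ ≤ 27648 * (#(S * S⁻¹) * #S) ^ 2 := h
    _ = #S * (27648 * (#(S * S⁻¹) ^ 2 * #S)) := by ring
    _ ≤ #S * (27648 * (M ^ 2 * M)) := by gcongr
    _ = #S * (27648 * M ^ 3) := by ring

lemma diffCount_le_diffCount_mul (S G : Finset ℝ) {g : ℝ} (hg : g ∈ G) (hg0 : g ≠ 0) (d : ℝ) :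
    diffCount S d ≤ diffCount (S * G) (d * g) := by
  apply card_le_card_of_injOn (fun p => (p.1 * g, p.2 * g))
  · intro p hp
    simp only [coe_filter, mem_product, Set.mem_ofPred_eq] at hp ⊢
    exact ⟨⟨mul_mem_mul hp.1.1 hg, mul_mem_mul hp.1.2 hg⟩, by rw [← hp.2]; ring⟩
  · rintro ⟨a, b⟩ - ⟨a', b'⟩ - h
    simpa [hg0] using h

lemma card_mul_popularDifferences_mul_le (S G B : Finset ℝ) (hS0 : (0 : ℝ) ∉ S)
    (hG0 : (0 : ℝ) ∉ G) (hB0 : (0 : ℝ) ∉ B) (M : ℕ) (hSG : #(S * G) ≤ M)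
    (hSGB : #(S * G * B) ≤ M) (t : ℕ) (ht : 1 ≤ t) :
    #B * #((popularDifferences S t).erase 0 * G) * t ^ 3 ≤ 27648 * M ^ 4 := by
  have h := card_popular_differences (S * G) B ((popularDifferences S t).erase 0 * G)
    (by
      rw [mem_mul]
      rintro ⟨s, hs, g, hg, h⟩
      rcases mul_eq_zero.1 h with rfl | rfl
      · exact hS0 hs
      · exact hG0 hg) hB0 t ht
    (fun x hx => by
      obtain ⟨d, hd, g, hg, rfl⟩ := mem_mul.1 hx
      exact (mem_filter.1 (mem_of_mem_erase hd)).2.trans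
        (diffCount_le_diffCount_mul S G hg (fun h => hG0 (h ▸ hg)) d))
  refine h.trans ?_
  calc 27648 * (#(S * G * B) * #(S * G)) ^ 2 ≤ 27648 * (M * M) ^ 2 := by gcongr
    _ = 27648 * M ^ 4 := by ring

lemma sum_diffCount_pow_three_le (S : Finset ℝ) (hS0 : (0 : ℝ) ∉ S) (M : ℕ) (hSM : #S ≤ M)
    (hM : #(S * S⁻¹) ≤ M) (K : ℕ) (hK1 : 1 ≤ K) (hK : #S < 2 ^ K) :
    ∑ d ∈ S - S, diffCount S d ^ 3 ≤ 248832 * K * M ^ 3 := by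
  have h1 := sum_pow_three_le_of_weak (S - S) (diffCount S) K (27648 * M ^ 3)
    (fun d _ => (diffCount_le_card S d).trans_lt hK)
    (fun t ht => card_popularDifferences_mul_le S hS0 M hSM hM t (by omega))
  have h2 : ∑ d ∈ S - S with ¬ 2 ≤ diffCount S d, diffCount S d ^ 3 ≤ M ^ 3 := by
    calc ∑ d ∈ S - S with ¬ 2 ≤ diffCount S d, diffCount S d ^ 3
        ≤ ∑ d ∈ S - S with ¬ 2 ≤ diffCount S d, 1 := sum_le_sum fun d hd =>
          Nat.pow_le_one_iff (by norm_num) |>.2 (by have := (mem_filter.1 hd).2; omega)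
      _ ≤ #(S - S) := by
          rw [← card_eq_sum_ones]
          exact card_filter_le _ _
      _ ≤ #S * #S := card_sub_le
      _ ≤ M * M := by gcongr
      _ = M ^ 2 := (sq M).symm
      _ ≤ M ^ 3 := by
        rcases Nat.eq_zero_or_pos M with rfl | hM0
        · simp
        · exact Nat.pow_le_pow_right hM0 (by norm_num)
  rw [← sum_filter_add_sum_filter_not (S - S) (fun d => 2 ≤ diffCount S d)]
  refine (add_le_add h1 h2).trans ?_
  calc 8 * K * (27648 * M ^ 3) + M ^ 3 = 221184 * K * M ^ 3 + 1 * M ^ 3 := by ring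
    _ ≤ 221184 * K * M ^ 3 + 27648 * K * M ^ 3 := by
        gcongr
        omega
    _ = 248832 * K * M ^ 3 := by ring

lemma mul_sum_pow_three_le {α : Type*} (s : Finset α) (f : α → ℕ) (c Q : ℕ)
    (h : ∀ a ∈ s, c * f a ^ 3 ≤ Q) : c * (∑ a ∈ s, f a) ^ 3 ≤ #s ^ 3 * Q := by
  rcases s.eq_empty_or_nonempty with rfl | hs
  · simp
  obtain ⟨m, hm, hmax⟩ := exists_max_image s f hs
  calc c * (∑ a ∈ s, f a) ^ 3 ≤ c * (#s * f m) ^ 3 := by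
        gcongr
        rw [← smul_eq_mul]
        exact sum_le_card_nsmul _ _ _ hmax
    _ = #s ^ 3 * (c * f m ^ 3) := by ring
    _ ≤ #s ^ 3 * Q := Nat.mul_le_mul_left _ (h m hm)

lemma sum_triples_sq_le_dyadic (S : Finset ℝ) (K : ℕ) (hK : #S < 2 ^ K) :
    ∑ z ∈ (S - S).erase 0 ×ˢ (S - S) with z.1 + z.2 ∈ S - S,
      diffCount S z.1 ^ 2 * diffCount S z.2 ^ 2 * diffCount S (z.1 + z.2) ^ 2 ≤
    ∑ q ∈ range K ×ˢ range K ×ˢ range K, 4 ^ (q.1 + 1) * 4 ^ (q.2.1 + 1) * 4 ^ (q.2.2 + 1) *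
      #{z ∈ (popularDifferences S (2 ^ q.1)).erase 0 ×ˢ popularDifferences S (2 ^ q.2.1) |
        z.1 + z.2 ∈ popularDifferences S (2 ^ q.2.2)} := by
  have hd : ∀ d, diffCount S d ^ 2 ≤
      ∑ i ∈ range K, 4 ^ (i + 1) * (if 2 ^ i ≤ diffCount S d then 1 else 0) := fun d =>
    sq_le_sum_dyadic _ K ((diffCount_le_card S d).trans_lt hK)
  set F := {z ∈ (S - S).erase 0 ×ˢ (S - S) | z.1 + z.2 ∈ S - S} with hF
  calc ∑ z ∈ F, diffCount S z.1 ^ 2 * diffCount S z.2 ^ 2 * diffCount S (z.1 + z.2) ^ 2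
      ≤ ∑ z ∈ F, (∑ i ∈ range K, 4 ^ (i + 1) * (if 2 ^ i ≤ diffCount S z.1 then 1 else 0)) *
          (∑ j ∈ range K, 4 ^ (j + 1) * (if 2 ^ j ≤ diffCount S z.2 then 1 else 0)) *
          (∑ k ∈ range K, 4 ^ (k + 1) * (if 2 ^ k ≤ diffCount S (z.1 + z.2) then 1 else 0)) :=
        sum_le_sum fun z _ => Nat.mul_le_mul (Nat.mul_le_mul (hd _) (hd _)) (hd _)
    _ = ∑ z ∈ F, ∑ q ∈ range K ×ˢ range K ×ˢ range K,
          4 ^ (q.1 + 1) * 4 ^ (q.2.1 + 1) * 4 ^ (q.2.2 + 1) *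
          (if 2 ^ q.1 ≤ diffCount S z.1 ∧ 2 ^ q.2.1 ≤ diffCount S z.2 ∧
            2 ^ q.2.2 ≤ diffCount S (z.1 + z.2) then 1 else 0) := by
        apply sum_congr rfl
        intro z _
        rw [mul_assoc, sum_mul_sum, sum_mul_sum, sum_product]
        apply sum_congr rfl
        intro i _
        rw [sum_product]
        apply sum_congr rfl
        intro j _
        rw [mul_sum]
        apply sum_congr rfl
        intro k _
        simp only [ite_and]
        split_ifs <;> ring
    _ = ∑ q ∈ range K ×ˢ range K ×ˢ range K,
          4 ^ (q.1 + 1) * 4 ^ (q.2.1 + 1) * 4 ^ (q.2.2 + 1) *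
          #{z ∈ F | 2 ^ q.1 ≤ diffCount S z.1 ∧ 2 ^ q.2.1 ≤ diffCount S z.2 ∧
            2 ^ q.2.2 ≤ diffCount S (z.1 + z.2)} := by
        rw [sum_comm]
        apply sum_congr rfl
        intro q _
        rw [← mul_sum, card_filter]
    _ ≤ _ := by
        apply sum_le_sum
        intro q _
        apply Nat.mul_le_mul_left
        apply card_le_card
        intro z hz
        simp only [hF, popularDifferences, mem_filter, mem_product, mem_erase] at hz ⊢
        tauto

lemma card_mul_sum_triples_pow_three_le (S G B : Finset ℝ) (hS0 : (0 : ℝ) ∉ S)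
    (hG0 : (0 : ℝ) ∉ G) (hB0 : (0 : ℝ) ∉ B) (M : ℕ) (hSM : #S ≤ M) (hM : #(S * S⁻¹) ≤ M)
    (hSG : #(S * G) ≤ M) (hSGB : #(S * G * B) ≤ M) (K : ℕ) (hK : #S < 2 ^ K) :
    #G * #B ^ 2 * (∑ z ∈ (S - S).erase 0 ×ˢ (S - S) with z.1 + z.2 ∈ S - S,
      diffCount S z.1 ^ 2 * diffCount S z.2 ^ 2 * diffCount S (z.1 + z.2) ^ 2) ^ 3 ≤
      64 ^ 3 * 27648 ^ 7 * K ^ 9 * M ^ 20 := by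
  refine (Nat.mul_le_mul_left _ (Nat.pow_le_pow_left (sum_triples_sq_le_dyadic S K hK) 3)).trans ?_
  refine (mul_sum_pow_three_le _ _ _ (64 ^ 3 * 27648 ^ 7 * M ^ 20) ?_).trans (le_of_eq ?_)
  · rintro ⟨i, j, k⟩ -
    simp only
    set X := (popularDifferences S (2 ^ i)).erase 0 with hX
    set Y := popularDifferences S (2 ^ j)
    set Z := popularDifferences S (2 ^ k)
    have hW := card_additive_triples X Y Z G (notMem_erase _ _) hG0
    have h1 : #B * #(X * G) * (2 ^ i) ^ 3 ≤ 27648 * M ^ 4 :=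
      card_mul_popularDifferences_mul_le S G B hS0 hG0 hB0 M hSG hSGB _ Nat.one_le_two_pow
    have h2 : #Y * (2 ^ j) ^ 3 ≤ 27648 * M ^ 3 :=
      card_popularDifferences_mul_le S hS0 M hSM hM _ Nat.one_le_two_pow
    have h3 : #Z * (2 ^ k) ^ 3 ≤ 27648 * M ^ 3 :=
      card_popularDifferences_mul_le S hS0 M hSM hM _ Nat.one_le_two_pow
    set W := #{z ∈ X ×ˢ Y | z.1 + z.2 ∈ Z}
    have hpow : ∀ n : ℕ, 4 ^ (n + 1) = 4 * (2 ^ n) ^ 2 := fun n => by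
      rw [pow_succ, ← pow_mul, mul_comm n 2, pow_mul]
      norm_num [mul_comm]
    rw [hpow, hpow, hpow]
    calc #G * #B ^ 2 * (4 * (2 ^ i) ^ 2 * (4 * (2 ^ j) ^ 2) * (4 * (2 ^ k) ^ 2) * W) ^ 3
        = 64 ^ 3 * #B ^ 2 * ((2 ^ i) ^ 3 * (2 ^ j) ^ 3 * (2 ^ k) ^ 3) ^ 2 * (#G * W ^ 3) := by ring
      _ ≤ 64 ^ 3 * #B ^ 2 * ((2 ^ i) ^ 3 * (2 ^ j) ^ 3 * (2 ^ k) ^ 3) ^ 2 *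
          (27648 * (#(X * G) * #Y * #Z) ^ 2) := Nat.mul_le_mul_left _ hW
      _ = 64 ^ 3 * 27648 * ((#B * #(X * G) * (2 ^ i) ^ 3) * (#Y * (2 ^ j) ^ 3) *
          (#Z * (2 ^ k) ^ 3)) ^ 2 := by ring
      _ ≤ 64 ^ 3 * 27648 * ((27648 * M ^ 4) * (27648 * M ^ 3) * (27648 * M ^ 3)) ^ 2 := by gcongr
      _ = 64 ^ 3 * 27648 ^ 7 * M ^ 20 := by ring
  · rw [card_product, card_product, card_range]
    ring

/-- Energy bound for a set with few ratios and few products with `G` and `B`. -/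
lemma additiveEnergy_le_or_le (S G B : Finset ℝ) (hS0 : (0 : ℝ) ∉ S)
    (hG0 : (0 : ℝ) ∉ G) (hB0 : (0 : ℝ) ∉ B) (M : ℕ) (hSM : #S ≤ M) (hM : #(S * S⁻¹) ≤ M)
    (hSG : #(S * G) ≤ M) (hSGB : #(S * G * B) ≤ M) (K : ℕ) (hK1 : 1 ≤ K) (hK : #S < 2 ^ K) :
    additiveEnergy S ^ 3 ≤ 2 * 248832 * K * M ^ 7 ∨
      #G * #B ^ 2 * additiveEnergy S ^ 18 ≤
        4 ^ 3 * 248832 ^ 3 * 64 ^ 3 * 27648 ^ 7 * K ^ 12 * M ^ 47 := by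
  set E := additiveEnergy S
  have hE := additiveEnergy_pow_three_le S
  have hdiag := sum_triples_diag_le S
  have hoff := sum_triples_offDiag_sq_le S
  have h3 := sum_diffCount_pow_three_le S hS0 M hSM hM K hK1 hK
  have hZ := card_mul_sum_triples_pow_three_le S G B hS0 hG0 hB0 M hSM hM hSG hSGB K hK
  rw [← sum_filter_add_sum_filter_not _ (fun t : (ℝ × ℝ) × ℝ => t.1.1 = t.1.2)] at hE
  set T := ∑ d ∈ S - S, diffCount S d ^ 3
  set Z := ∑ z ∈ (S - S).erase 0 ×ˢ (S - S) with z.1 + z.2 ∈ S - S,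
      diffCount S z.1 ^ 2 * diffCount S z.2 ^ 2 * diffCount S (z.1 + z.2) ^ 2
  set P := ∑ t ∈ (S ×ˢ S) ×ˢ S with t.1.1 = t.1.2,
      diffCount S (t.1.1 - t.1.2) * diffCount S (t.1.2 - t.2) * diffCount S (t.1.1 - t.2)
  set R := ∑ t ∈ (S ×ˢ S) ×ˢ S with t.1.1 ≠ t.1.2,
      diffCount S (t.1.1 - t.1.2) * diffCount S (t.1.2 - t.2) * diffCount S (t.1.1 - t.2)
  rcases le_total R P with h | h
  · left
    calc E ^ 3 ≤ #S ^ 3 * (P + R) := hE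
      _ ≤ M ^ 3 * (M * (248832 * K * M ^ 3) + M * (248832 * K * M ^ 3)) := by
          have : P ≤ M * (248832 * K * M ^ 3) := hdiag.trans (by gcongr)
          gcongr
          exact h.trans this
      _ = 2 * 248832 * K * M ^ 7 := by ring
  · right
    have hER : E ^ 3 ≤ M ^ 3 * (2 * R) := hE.trans (by gcongr; omega)
    calc #G * #B ^ 2 * E ^ 18 = #G * #B ^ 2 * (E ^ 3) ^ 6 := by ring
      _ ≤ #G * #B ^ 2 * (M ^ 3 * (2 * R)) ^ 6 := by gcongr
      _ = #G * #B ^ 2 * 4 ^ 3 * M ^ 18 * (R ^ 2) ^ 3 := by ring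
      _ ≤ #G * #B ^ 2 * 4 ^ 3 * M ^ 18 * ((248832 * K * M ^ 3) * Z) ^ 3 := by
          gcongr
          exact hoff.trans (by gcongr)
      _ = 4 ^ 3 * M ^ 18 * (248832 * K * M ^ 3) ^ 3 * (#G * #B ^ 2 * Z ^ 3) := by ring
      _ ≤ 4 ^ 3 * M ^ 18 * (248832 * K * M ^ 3) ^ 3 *
          (64 ^ 3 * 27648 ^ 7 * K ^ 9 * M ^ 20) := Nat.mul_le_mul_left _ hZ
      _ = 4 ^ 3 * 248832 ^ 3 * 64 ^ 3 * 27648 ^ 7 * K ^ 12 * M ^ 47 := by ring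

lemma zero_notMem_mul {S T : Finset ℝ} (hS : (0 : ℝ) ∉ S) (hT : (0 : ℝ) ∉ T) :
    (0 : ℝ) ∉ S * T := by
  rw [mem_mul]
  rintro ⟨s, hs, t, ht, h⟩
  rcases mul_eq_zero.1 h with rfl | rfl
  · exact hS hs
  · exact hT ht

lemma card_le_card_mul_right (S B : Finset ℝ) (hS : S.Nonempty) (hS0 : (0 : ℝ) ∉ S) :
    #B ≤ #(B * S) := by
  rw [mul_comm]
  exact card_right_le_card_mul S B hS hS0

lemma ratio_energy_bounds (S : Finset ℝ) (hSne : S.Nonempty) (hS : (0 : ℝ) ∉ S) (K : ℕ)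
    (hK1 : 1 ≤ K) (hK : #(S * (S / S)) < 2 ^ K) :
    #(S / S) ≤ #((S * S * S * S) / (S * S * S * S)) ∧
    (additiveEnergy (S * (S / S)) ^ 3 ≤
        2 * 248832 * K * #((S * S * S * S) / (S * S * S * S)) ^ 7 ∨
      #(S / S) ^ 3 * additiveEnergy (S * (S / S)) ^ 18 ≤
        4 ^ 3 * 248832 ^ 3 * 64 ^ 3 * 27648 ^ 7 * K ^ 12 *
          #((S * S * S * S) / (S * S * S * S)) ^ 47) := by
  set M := #((S * S * S * S) / (S * S * S * S)) with hM
  set G := S / S with hG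
  set B := S⁻¹ * G with hB
  have hG0 : (0 : ℝ) ∉ G := zero_notMem_div_self _ hS
  have hI0 : (0 : ℝ) ∉ S⁻¹ := by simpa using hS
  have hB0 : (0 : ℝ) ∉ B := zero_notMem_mul hI0 hG0
  have hGne : G.Nonempty := hSne.div hSne
  have hBne : B.Nonempty := hSne.inv.mul hGne
  have hΓ0 : (0 : ℝ) ∉ S * G := zero_notMem_mul hS hG0
  have e1 : S * G * G * B = (S * S * S * S) / (S * S * S * S) := by
    simp only [hB, hG, div_eq_mul_inv, mul_inv]
    ac_rfl
  have e2 : (S * G) * (S * G)⁻¹ * G = (S * S * S * S) / (S * S * S * S) := by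
    simp only [hG, div_eq_mul_inv, mul_inv, inv_inv]
    ac_rfl
  have h1 : #(S * G * G * B) ≤ M := by rw [e1]
  have h2 : #(S * G * G) ≤ M := (card_le_card_mul_right B _ hBne hB0).trans h1
  have h3 : #(S * G) ≤ M := (card_le_card_mul_right G _ hGne hG0).trans h2
  have h4 : #((S * G) * (S * G)⁻¹) ≤ M :=
    (card_le_card_mul_right G _ hGne hG0).trans (by rw [e2])
  have h5 : #G ≤ #B := card_right_le_card_mul _ _ hSne.inv hI0
  refine ⟨(card_right_le_card_mul S G hSne hS).trans h3, ?_⟩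
  refine (additiveEnergy_le_or_le (S * G) G B hΓ0 hG0 hB0 M h3 h4 h2 h1 K hK1 hK).imp_right ?_
  intro h
  refine le_trans ?_ h
  calc #G ^ 3 * additiveEnergy (S * G) ^ 18
      = #G * #G ^ 2 * additiveEnergy (S * G) ^ 18 := by ring
    _ ≤ #G * #B ^ 2 * additiveEnergy (S * G) ^ 18 := by gcongr

lemma exists_card_pow_le :
    ∃ D : ℕ, 1 ≤ D ∧ ∀ (A : Finset ℝ) (K : ℕ), A.Nonempty → (0 : ℝ) ∉ A + A → 1 ≤ K →
      #A ^ 6 < 2 ^ K → ∀ M : ℕ,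
      M = #(((A + A) * (A + A) * (A + A) * (A + A)) / ((A + A) * (A + A) * (A + A) * (A + A))) →
      #A ^ 3 ≤ M ∨ #A ^ 15 ≤ D * K ^ 10 * M ^ 7 ∨ #A ^ 96 ≤ D * K ^ 72 * M ^ 47 := by
  obtain ⟨a, ha⟩ : ∃ a : ℕ, a = 16 * 221184 ^ 2 := ⟨_, rfl⟩
  obtain ⟨b, hb⟩ : ∃ b : ℕ, b = 442368 := ⟨_, rfl⟩
  obtain ⟨c, hc⟩ : ∃ c : ℕ, c = 2 * 248832 := ⟨_, rfl⟩
  obtain ⟨d, hd⟩ : ∃ d : ℕ, d = 4 ^ 3 * 248832 ^ 3 * 64 ^ 3 * 27648 ^ 7 := ⟨_, rfl⟩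
  refine ⟨a ^ 3 * b ^ 3 * c + a ^ 21 * b ^ 18 * d, by subst ha hb hc; omega, ?_⟩
  rintro A K hA hS hK1 hK M rfl
  set S := A + A with hSdef
  set M := #((S * S * S * S) / (S * S * S * S))
  have hSne : S.Nonempty := hA.add hA
  have hN : 0 < #A := card_pos.2 hA
  have hAK : #A < 2 ^ K := (Nat.le_self_pow (by norm_num) _).trans_lt hK
  have hΓ : #(S * (S / S)) < 2 ^ K := by
    refine lt_of_le_of_lt ?_ hK
    have hS2 : #S ≤ #A * #A := card_add_le
    calc #(S * (S / S)) ≤ #S * #(S / S) := card_mul_le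
      _ ≤ #S * (#S * #S) := Nat.mul_le_mul_left _ card_div_le
      _ ≤ (#A * #A) * ((#A * #A) * (#A * #A)) := by gcongr
      _ = #A ^ 6 := by ring
  obtain ⟨hYM, hE⟩ := ratio_energy_bounds S hSne hS K hK1 hΓ
  rcases le_total (#(S / S)) (#A ^ 3) with hY | hY
  swap
  · exact Or.inl (hY.trans hYM)
  right
  have h1 := sq_card_le_card_ratios A hA hS K hAK
  have h2 := card_mul_le_additiveEnergy A (S / S) hA (hSne.div hSne) hS
    (zero_notMem_div_self _ hS) K hAK hY
  rw [← hSdef] at h1 h2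
  rw [← hb] at h2
  rw [← hc, ← hd] at hE
  set E := additiveEnergy (S * (S / S))
  set Y := #(S / S)
  set N := #A
  have h1' : N ^ 2 ≤ a * K ^ 2 * Y := h1.trans (by rw [ha]; exact le_of_eq (by ring))
  have h5 : N ^ 5 ≤ a * b * K ^ 3 * E := by
    calc N ^ 5 = N ^ 3 * N ^ 2 := by ring
      _ ≤ N ^ 3 * (a * K ^ 2 * Y) := Nat.mul_le_mul_left _ h1'
      _ = a * K ^ 2 * (N ^ 3 * Y) := by ring
      _ ≤ a * K ^ 2 * (b * K * E) := Nat.mul_le_mul_left _ h2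
      _ = a * b * K ^ 3 * E := by ring
  refine hE.imp (fun h => ?_) (fun h => ?_)
  · calc N ^ 15 = (N ^ 5) ^ 3 := by ring
      _ ≤ (a * b * K ^ 3 * E) ^ 3 := Nat.pow_le_pow_left h5 3
      _ = a ^ 3 * b ^ 3 * K ^ 9 * E ^ 3 := by ring
      _ ≤ a ^ 3 * b ^ 3 * K ^ 9 * (c * K * M ^ 7) := Nat.mul_le_mul_left _ h
      _ = a ^ 3 * b ^ 3 * c * K ^ 10 * M ^ 7 := by ring
      _ ≤ _ := by gcongr; exact Nat.le_add_right _ _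
  · calc N ^ 96 = (N ^ 5) ^ 18 * (N ^ 2) ^ 3 := by ring
      _ ≤ (a * b * K ^ 3 * E) ^ 18 * (a * K ^ 2 * Y) ^ 3 :=
        Nat.mul_le_mul (Nat.pow_le_pow_left h5 18) (Nat.pow_le_pow_left h1' 3)
      _ = a ^ 21 * b ^ 18 * K ^ 60 * (Y ^ 3 * E ^ 18) := by ring
      _ ≤ a ^ 21 * b ^ 18 * K ^ 60 * (d * K ^ 12 * M ^ 47) := Nat.mul_le_mul_left _ h
      _ = a ^ 21 * b ^ 18 * d * K ^ 72 * M ^ 47 := by ring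
      _ ≤ _ := by gcongr; exact Nat.le_add_left _ _

lemma inv_mul_rpow_div_sq_le {N L D M : ℝ} (hN : 1 ≤ N) (hL : 1 ≤ L) (hD : 1 ≤ D) (hM : 0 ≤ M)
    {p q r : ℕ} (hq : 1 ≤ q) (hpq : 100 * q ≤ 49 * p) (hr : r ≤ 2 * q)
    (h : N ^ p ≤ D * L ^ r * M ^ q) : D⁻¹ * N ^ ((100 : ℝ) / 49) / L ^ 2 ≤ M := by
  have hD0 : 0 < D := by linarith
  have hL0 : 0 < L := by linarith
  have hpow : (N ^ ((100 : ℝ) / 49)) ^ q ≤ N ^ p := by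
    rw [← Real.rpow_natCast, ← Real.rpow_mul (by linarith), ← Real.rpow_natCast]
    apply Real.rpow_le_rpow_of_exponent_le hN
    have : (100 : ℝ) * q ≤ 49 * p := by exact_mod_cast hpq
    linarith
  have key : N ^ ((100 : ℝ) / 49) ≤ D * L ^ 2 * M := by
    refine le_of_pow_le_pow_left₀ (n := q) (by omega) (by positivity) ?_
    calc (N ^ ((100 : ℝ) / 49)) ^ q ≤ N ^ p := hpow
      _ ≤ D * L ^ r * M ^ q := h
      _ ≤ D ^ q * L ^ (2 * q) * M ^ q := by
          gcongr
          exact le_self_pow₀ hD (by omega)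
      _ = (D * L ^ 2 * M) ^ q := by rw [mul_pow, mul_pow, pow_mul]
  rw [div_le_iff₀ (by positivity), inv_mul_le_iff₀ hD0]
  linarith

theorem stmt_13 :
    ∃ c C : ℝ, 0 < c ∧ 0 < C ∧ ∀ A : Finset ℝ,
      2 ≤ A.card → (0 : ℝ) ∉ A + A →
      c * (A.card : ℝ) ^ ((100 : ℝ) / 49) / (Real.logb 2 (A.card : ℝ)) ^ C
        ≤ ((((A + A) * (A + A) * (A + A) * (A + A)) /
            ((A + A) * (A + A) * (A + A) * (A + A))).card : ℝ) := by
  obtain ⟨D, hD1, hD⟩ := exists_card_pow_le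
  refine ⟨((D : ℝ) * 7 ^ 72)⁻¹, 2, by positivity, by norm_num, fun A hA2 hS => ?_⟩
  have hA : A.Nonempty := card_pos.1 (by omega)
  obtain ⟨M, hM⟩ : ∃ M, M = #(((A + A) * (A + A) * (A + A) * (A + A)) /
    ((A + A) * (A + A) * (A + A) * (A + A))) := ⟨_, rfl⟩
  set K := Nat.log 2 (#A ^ 6) + 1 with hK
  have h := hD A K hA hS (by omega) (Nat.lt_pow_succ_log_self (by norm_num) _) M hM
  rw [← hM, Real.rpow_two]
  set L := Real.logb 2 (#A : ℝ) with hL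
  have hN : (2 : ℝ) ≤ #A := by exact_mod_cast hA2
  have hL1 : 1 ≤ L := by
    rw [hL, Real.le_logb_iff_rpow_le (by norm_num) (by linarith)]
    simpa using hN
  have hKL : (K : ℝ) ≤ 7 * L := by
    have h6 : (Nat.log 2 (#A ^ 6) : ℝ) ≤ 6 * L := by
      have := Real.natLog_le_logb (#A ^ 6) 2
      push_cast [Real.logb_pow] at this
      exact this
    rw [hK]
    push_cast
    linarith
  have hD1' : (1 : ℝ) ≤ D := by exact_mod_cast hD1
  have hDD : (1 : ℝ) ≤ D * 7 ^ 72 := by nlinarith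
  rcases h with h | h | h
  · refine inv_mul_rpow_div_sq_le (p := 3) (q := 1) (r := 0) (by linarith) hL1 hDD
      (Nat.cast_nonneg M) (by norm_num) (by norm_num) (by norm_num) ?_
    have h' : (#A : ℝ) ^ 3 ≤ M := by exact_mod_cast h
    rw [pow_zero, mul_one, pow_one]
    exact h'.trans (le_mul_of_one_le_left (Nat.cast_nonneg M) hDD)
  · refine inv_mul_rpow_div_sq_le (p := 15) (q := 7) (r := 10) (by linarith) hL1 hDD
      (Nat.cast_nonneg M) (by norm_num) (by norm_num) (by norm_num) ?_
    have h' : (#A : ℝ) ^ 15 ≤ D * K ^ 10 * M ^ 7 := by exact_mod_cast h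
    calc (#A : ℝ) ^ 15 ≤ D * K ^ 10 * M ^ 7 := h'
      _ ≤ D * (7 * L) ^ 10 * M ^ 7 := by gcongr
      _ = D * 7 ^ 10 * L ^ 10 * M ^ 7 := by ring
      _ ≤ D * 7 ^ 72 * L ^ 10 * M ^ 7 := by gcongr <;> norm_num
  · refine inv_mul_rpow_div_sq_le (p := 96) (q := 47) (r := 72) (by linarith) hL1 hDD
      (Nat.cast_nonneg M) (by norm_num) (by norm_num) (by norm_num) ?_
    have h' : (#A : ℝ) ^ 96 ≤ D * K ^ 72 * M ^ 47 := by exact_mod_cast h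
    calc (#A : ℝ) ^ 96 ≤ D * K ^ 72 * M ^ 47 := h'
      _ ≤ D * (7 * L) ^ 72 * M ^ 47 := by gcongr
      _ = D * 7 ^ 72 * L ^ 72 * M ^ 47 := by ring
end

section
/- There exists an absolute constant c > 0 such that for every finite set A ⊆ ℝ with |A| ≥ 2, the set R′[A] := {(b+c)/(b′+c) : b, b′, c ∈ A, b′+c ≠ 0} satisfies |R′[A]| ≥ c · |A|² / log |A|. -/
open Finset Pointwise

/-- The number of elements of `B` below `x`. -/
noncomputable def rankIn (B : Finset ℝ) (x : ℝ) : ℕ := (B.filter (· < x)).card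

lemma rankIn_mono (B : Finset ℝ) : Monotone (rankIn B) := fun _ _ h =>
  card_le_card fun _ hz => by
    simp only [mem_filter] at hz ⊢
    exact ⟨hz.1, hz.2.trans_le h⟩

lemma rankIn_lt_of_lt {B : Finset ℝ} {x y : ℝ} (hx : x ∈ B) (h : x < y) :
    rankIn B x < rankIn B y := by
  refine card_lt_card ⟨fun z hz => ?_, fun hs => ?_⟩
  · simp only [mem_filter] at hz ⊢
    exact ⟨hz.1, hz.2.trans h⟩
  · have := hs (show x ∈ _ from by simp [hx, h])
    simp at this

lemma rankIn_lt_card {B : Finset ℝ} {x : ℝ} (hx : x ∈ B) : rankIn B x < B.card := by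
  refine card_lt_card ⟨filter_subset _ _, fun hs => ?_⟩
  have := hs hx
  simp at this

lemma rankIn_injOn (B : Finset ℝ) : Set.InjOn (rankIn B) B := by
  intro x hx y hy h
  rcases lt_trichotomy x y with hxy | hxy | hxy
  · exact absurd h (rankIn_lt_of_lt hx hxy).ne
  · exact hxy
  · exact absurd h (rankIn_lt_of_lt hy hxy).ne'

/-- The cell containing `p`, when `B` is cut into blocks of `w` consecutive elements. -/
noncomputable def gridCell (B : Finset ℝ) (w : ℕ) (p : ℝ × ℝ) : ℕ × ℕ :=
  (rankIn B p.1 / w, rankIn B p.2 / w)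

lemma card_pairs_same_block (B : Finset ℝ) {w : ℕ} (hw : 0 < w) :
    ((B ×ˢ B).filter fun z => rankIn B z.1 / w = rankIn B z.2 / w).card ≤ B.card * w := by
  have : ((B ×ˢ B).filter fun z => rankIn B z.1 / w = rankIn B z.2 / w).card ≤
      (B ×ˢ range w).card := by
    refine card_le_card_of_injOn (fun z => (z.1, rankIn B z.2 % w)) ?_ ?_
    · rintro ⟨x, y⟩ h
      simp only [coe_filter, mem_product, Set.mem_ofPred_eq] at h
      simp [h.1.1, Nat.mod_lt _ hw]
    · rintro ⟨x, y⟩ h ⟨x', y'⟩ h' he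
      simp only [coe_filter, mem_product, Set.mem_ofPred_eq] at h h'
      simp only [Prod.mk.injEq] at he ⊢
      obtain ⟨rfl, he⟩ := he
      refine ⟨rfl, rankIn_injOn B h.1.2 h'.1.2 ?_⟩
      rw [← Nat.div_add_mod (rankIn B y) w, ← Nat.div_add_mod (rankIn B y') w, ← h.2, ← h'.2, he]
  simpa using this

lemma card_pairs_same_cell (B : Finset ℝ) {w : ℕ} (hw : 0 < w) :
    (((B ×ˢ B) ×ˢ (B ×ˢ B)).filter fun z => gridCell B w z.1 = gridCell B w z.2).card ≤
      (B.card * w) ^ 2 := by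
  refine le_trans ?_ (Nat.pow_le_pow_left (card_pairs_same_block B hw) 2)
  rw [sq, ← card_product]
  refine card_le_card_of_injOn (fun z => ((z.1.1, z.2.1), (z.1.2, z.2.2))) ?_ ?_
  · rintro ⟨⟨a, b⟩, ⟨c, d⟩⟩ h
    simp only [coe_filter, mem_product, Set.mem_ofPred_eq, gridCell, Prod.mk.injEq] at h
    simp [h]
  · rintro ⟨⟨a, b⟩, ⟨c, d⟩⟩ _ ⟨⟨a', b'⟩, ⟨c', d'⟩⟩ _ h
    simp only [Prod.mk.injEq] at h ⊢
    tauto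

/-- The points of `B ×ˢ B` on the line `y = l.1 * x + l.2`. -/
noncomputable def gridLine (B : Finset ℝ) (l : ℝ × ℝ) : Finset (ℝ × ℝ) :=
  (B ×ˢ B).filter fun p => p.2 = l.1 * p.1 + l.2

lemma mem_gridLine {B : Finset ℝ} {l p : ℝ × ℝ} :
    p ∈ gridLine B l ↔ (p.1 ∈ B ∧ p.2 ∈ B) ∧ p.2 = l.1 * p.1 + l.2 := by
  simp [gridLine]

lemma card_gridLine_le (B : Finset ℝ) (l : ℝ × ℝ) : (gridLine B l).card ≤ B.card := by
  refine card_le_card_of_injOn Prod.fst (fun p hp => (mem_gridLine.1 hp).1.1) ?_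
  intro p hp q hq h
  have hp' := (mem_gridLine.1 hp).2
  have hq' := (mem_gridLine.1 hq).2
  exact Prod.ext h (by rw [hp', hq', h])

lemma line_unique {l l' p q : ℝ × ℝ} (hpq : p ≠ q)
    (h₁ : p.2 = l.1 * p.1 + l.2) (h₂ : q.2 = l.1 * q.1 + l.2)
    (h₃ : p.2 = l'.1 * p.1 + l'.2) (h₄ : q.2 = l'.1 * q.1 + l'.2) : l = l' := by
  have hx : p.1 - q.1 ≠ 0 := fun h => hpq (Prod.ext (sub_eq_zero.1 h) (by
    rw [h₁, h₂, sub_eq_zero.1 h]))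
  have hs : l.1 = l'.1 := mul_right_cancel₀ hx (by linarith)
  exact Prod.ext hs (by rw [hs] at h₁; linarith)

lemma card_cells_le (B : Finset ℝ) (w : ℕ) {l : ℝ × ℝ} (hl : l.1 ≠ 0) :
    ((gridLine B l).image (gridCell B w)).card ≤ 2 * ((B.card - 1) / w) + 1 := by
  set q := (B.card - 1) / w with hq
  have hle : ∀ x ∈ B, rankIn B x / w ≤ q := fun x hx =>
    Nat.div_le_div_right (Nat.le_sub_one_of_lt (rankIn_lt_card hx))
  have hm : ∀ x y, x ≤ y → rankIn B x / w ≤ rankIn B y / w := fun x y h =>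
    Nat.div_le_div_right (rankIn_mono B h)
  rw [← card_range (2 * q + 1)]
  rcases lt_or_gt_of_ne hl with hneg | hpos
  · refine card_le_card_of_injOn (fun c => c.1 + (q - c.2)) ?_ ?_
    · intro c hc
      obtain ⟨p, hp, rfl⟩ := mem_image.1 (mem_coe.1 hc)
      have := hle _ (mem_gridLine.1 hp).1.1
      have := Nat.sub_le q (rankIn B p.2 / w)
      simp only [gridCell, coe_range, Set.mem_Iio]
      omega
    · intro c hc c' hc' h
      obtain ⟨p, hp, rfl⟩ := mem_image.1 (mem_coe.1 hc)
      obtain ⟨p', hp', rfl⟩ := mem_image.1 (mem_coe.1 hc')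
      obtain ⟨⟨-, hy⟩, e⟩ := mem_gridLine.1 hp
      obtain ⟨⟨-, hy'⟩, e'⟩ := mem_gridLine.1 hp'
      have b := hle _ hy
      have b' := hle _ hy'
      simp only [gridCell, Prod.mk.injEq] at h ⊢
      rcases le_total p.1 p'.1 with hx | hx
      · have h1 := hm _ _ hx
        have h2 := hm p'.2 p.2 (by rw [e, e']; nlinarith)
        omega
      · have h1 := hm _ _ hx
        have h2 := hm p.2 p'.2 (by rw [e, e']; nlinarith)
        omega
  · refine card_le_card_of_injOn (fun c => c.1 + c.2) ?_ ?_
    · intro c hc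
      obtain ⟨p, hp, rfl⟩ := mem_image.1 (mem_coe.1 hc)
      have := hle _ (mem_gridLine.1 hp).1.1
      have := hle _ (mem_gridLine.1 hp).1.2
      simp only [gridCell, coe_range, Set.mem_Iio]
      omega
    · intro c hc c' hc' h
      obtain ⟨p, hp, rfl⟩ := mem_image.1 (mem_coe.1 hc)
      obtain ⟨p', hp', rfl⟩ := mem_image.1 (mem_coe.1 hc')
      have e := (mem_gridLine.1 hp).2
      have e' := (mem_gridLine.1 hp').2
      simp only [gridCell, Prod.mk.injEq] at h ⊢
      rcases le_total p.1 p'.1 with hx | hx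
      · have h1 := hm _ _ hx
        have h2 := hm p.2 p'.2 (by rw [e, e']; nlinarith)
        omega
      · have h1 := hm _ _ hx
        have h2 := hm p'.2 p.2 (by rw [e, e']; nlinarith)
        omega

lemma card_le_card_image_add_card_collisions {α β : Type*} [DecidableEq α] [DecidableEq β]
    (S : Finset α) (f : α → β) :
    S.card ≤ (S.image f).card + (S.offDiag.filter fun z => f z.1 = f z.2).card := by
  rcases S.eq_empty_or_nonempty with rfl | ⟨x₀, -⟩
  · simp
  have : Nonempty α := ⟨x₀⟩
  choose! g hgS hg using fun (y : β) (hy : y ∈ S.image f) => mem_image.1 hy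
  have h1 : ((S.image f).image g).card ≤ (S.image f).card := card_image_le
  have h2 : (S \ (S.image f).image g).card ≤ (S.offDiag.filter fun z => f z.1 = f z.2).card := by
    refine card_le_card_of_injOn (fun x => (x, g (f x))) ?_ fun x _ y _ h => (Prod.mk.inj h).1
    intro x hx
    obtain ⟨hxS, hx'⟩ := mem_sdiff.1 (mem_coe.1 hx)
    have hfx := mem_image_of_mem f hxS
    simp only [coe_filter, mem_offDiag, Set.mem_ofPred_eq]
    refine ⟨⟨hxS, hgS _ hfx, fun h => hx' ?_⟩, (hg _ hfx).symm⟩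
    exact mem_image.2 ⟨f x, hfx, h.symm⟩
  have h3 := card_le_card_sdiff_add_card (s := S) (t := (S.image f).image g)
  omega

/-- Pairs of distinct points on a line lying in a common cell. -/
noncomputable def lineCellPairs (B : Finset ℝ) (w : ℕ) (l : ℝ × ℝ) :
    Finset ((ℝ × ℝ) × (ℝ × ℝ)) :=
  (gridLine B l).offDiag.filter fun z => gridCell B w z.1 = gridCell B w z.2

lemma sum_card_lineCellPairs_le (B : Finset ℝ) {w : ℕ} (hw : 0 < w) (L : Finset (ℝ × ℝ)) :
    ∑ l ∈ L, (lineCellPairs B w l).card ≤ (B.card * w) ^ 2 := by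
  refine le_trans ?_ (card_pairs_same_cell B hw)
  rw [← card_biUnion]
  · refine card_le_card fun z hz => ?_
    obtain ⟨l, -, hz⟩ := mem_biUnion.1 hz
    simp only [lineCellPairs, mem_filter, mem_offDiag, mem_gridLine] at hz
    simp only [mem_filter, mem_product]
    exact ⟨⟨hz.1.1.1, hz.1.2.1.1⟩, hz.2⟩
  · intro l _ l' _ hll
    refine disjoint_left.2 fun z hz hz' => hll ?_
    simp only [lineCellPairs, mem_filter, mem_offDiag, mem_gridLine] at hz hz'
    exact line_unique hz.1.2.2 hz.1.1.2 hz.1.2.1.2 hz'.1.1.2 hz'.1.2.1.2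

lemma card_gridLine_le_mul_lineCellPairs (B : Finset ℝ) {w : ℕ} {l : ℝ × ℝ} (hl : l.1 ≠ 0)
    (hk : 2 ≤ (gridLine B l).card) (hw : 4 * B.card ≤ w * (gridLine B l).card) :
    (gridLine B l).card ≤ 4 * (lineCellPairs B w l).card := by
  have h1 := card_le_card_image_add_card_collisions (gridLine B l) (gridCell B w)
  have h2 := card_cells_le B w hl
  change _ ≤ _ + (lineCellPairs B w l).card at h1
  have hN := card_gridLine_le B l
  have hwpos : 0 < w := by
    rcases Nat.eq_zero_or_pos w with rfl | h
    · omega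
    · exact h
  set k := (gridLine B l).card
  set q := (B.card - 1) / w
  have hq : q * w ≤ B.card - 1 := Nat.div_mul_le_self _ _
  have : 4 * q < k := by
    by_contra! h
    have : w * k ≤ w * (4 * q) := Nat.mul_le_mul_left _ h
    have : w * (4 * q) = 4 * (q * w) := by ring
    omega
  omega

lemma exists_dyadic_scale {N k : ℕ} (hk : 2 ≤ k) (hkN : k ≤ N) :
    ∃ j ∈ range (Nat.log 2 N + 3), 4 * N ≤ 2 ^ j * k ∧ 2 ^ j * k ≤ 8 * N := by
  have hex : ∃ j, 4 * N ≤ 2 ^ j * k :=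
    ⟨4 * N, (Nat.lt_two_pow_self (n := 4 * N)).le.trans (Nat.le_mul_of_pos_right _ (by omega))⟩
  classical
  obtain ⟨i, hi⟩ : ∃ i, Nat.find hex = i + 1 := by
    refine Nat.exists_eq_succ_of_ne_zero fun h => ?_
    have := Nat.find_spec hex
    rw [h] at this
    omega
  have h1 := Nat.find_spec hex
  have h2 : ¬ 4 * N ≤ 2 ^ i * k := Nat.find_min hex (by omega)
  rw [hi] at h1
  refine ⟨i + 1, ?_, h1, by rw [pow_succ]; linarith⟩
  have h3 : 2 ^ i * 2 ≤ 2 ^ i * k := Nat.mul_le_mul_left _ hk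
  have h4 : N < 2 ^ (Nat.log 2 N + 1) := Nat.lt_pow_succ_log_self (by norm_num) N
  have h5 : 2 ^ i < 2 ^ (Nat.log 2 N + 2) := by
    rw [pow_succ 2 (Nat.log 2 N + 1)]; omega
  have := (Nat.pow_lt_pow_iff_right (by norm_num : 1 < 2)).1 h5
  exact mem_range.2 (by omega)

theorem sum_card_gridLine_cube_le (B : Finset ℝ) (L : Finset (ℝ × ℝ)) (hL : ∀ l ∈ L, l.1 ≠ 0)
    (hL2 : ∀ l ∈ L, 2 ≤ (gridLine B l).card) :
    ∑ l ∈ L, ((gridLine B l).card : ℝ) ^ 3 ≤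
      256 * (Nat.log 2 B.card + 3 : ℕ) * (B.card : ℝ) ^ 4 := by
  set N := B.card with hN
  have key : ∀ l ∈ L, ((gridLine B l).card : ℝ) ^ 3 ≤
      ∑ j ∈ range (Nat.log 2 N + 3),
        256 * (N : ℝ) ^ 2 / (2 ^ j) ^ 2 * ((lineCellPairs B (2 ^ j) l).card : ℝ) := by
    intro l hl
    obtain ⟨j, hj, h1, h2⟩ := exists_dyadic_scale (hL2 l hl) (card_gridLine_le B l)
    refine le_trans ?_ (single_le_sum (f := fun j => 256 * (N : ℝ) ^ 2 / (2 ^ j) ^ 2 *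
      ((lineCellPairs B (2 ^ j) l).card : ℝ)) (fun i _ => by positivity) hj)
    have h3 := card_gridLine_le_mul_lineCellPairs B (hL l hl) (hL2 l hl) h1
    have h3' : ((gridLine B l).card : ℝ) ≤ 4 * ((lineCellPairs B (2 ^ j) l).card : ℝ) := by
      exact_mod_cast h3
    have h2' : (2 : ℝ) ^ j * ((gridLine B l).card : ℝ) ≤ 8 * N := by exact_mod_cast h2
    have hp : (0 : ℝ) < 2 ^ j := by positivity
    set k := ((gridLine B l).card : ℝ)
    have hk0 : (0 : ℝ) ≤ k := Nat.cast_nonneg _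
    rw [div_mul_eq_mul_div, le_div_iff₀ (by positivity)]
    calc k ^ 3 * (2 ^ j) ^ 2 = (2 ^ j * k) ^ 2 * k := by ring
      _ ≤ (8 * N) ^ 2 * (4 * ((lineCellPairs B (2 ^ j) l).card : ℝ)) := by gcongr
      _ = _ := by ring
  calc _ ≤ _ := sum_le_sum key
    _ = ∑ j ∈ range (Nat.log 2 N + 3), 256 * (N : ℝ) ^ 2 / (2 ^ j) ^ 2 *
          ((∑ l ∈ L, (lineCellPairs B (2 ^ j) l).card : ℕ) : ℝ) := by
        rw [sum_comm]
        simp only [Nat.cast_sum, mul_sum]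
    _ ≤ ∑ j ∈ range (Nat.log 2 N + 3), 256 * (N : ℝ) ^ 4 := by
        refine sum_le_sum fun j _ => ?_
        have h : ((∑ l ∈ L, (lineCellPairs B (2 ^ j) l).card : ℕ) : ℝ) ≤ (N * 2 ^ j) ^ 2 := by
          exact_mod_cast sum_card_lineCellPairs_le B (w := 2 ^ j) (by positivity) L
        calc _ ≤ 256 * (N : ℝ) ^ 2 / (2 ^ j) ^ 2 * (N * 2 ^ j) ^ 2 := by gcongr
          _ = _ := by field_simp
    _ = _ := by rw [sum_const, card_range, nsmul_eq_mul]; ring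

/-- Triples `(b, b', c)` with `b ≠ b'` and `b' + c ≠ 0`. -/
noncomputable def ratioTriples (A : Finset ℝ) : Finset (ℝ × ℝ × ℝ) :=
  (A ×ˢ A ×ˢ A).filter fun t => t.1 ≠ t.2.1 ∧ t.2.1 + t.2.2 ≠ 0

/-- The ratio `(b + c) / (b' + c)` of the triple `(b, b', c)`. -/
noncomputable def tripleRatio (t : ℝ × ℝ × ℝ) : ℝ := (t.1 + t.2.2) / (t.2.1 + t.2.2)

/-- Slope and intercept of the line through `p` and `q`. -/
noncomputable def lineThrough (p q : ℝ × ℝ) : ℝ × ℝ :=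
  ((p.2 - q.2) / (p.1 - q.1), p.2 - (p.2 - q.2) / (p.1 - q.1) * p.1)

lemma lineThrough_left (p q : ℝ × ℝ) :
    p.2 = (lineThrough p q).1 * p.1 + (lineThrough p q).2 := by
  simp [lineThrough]

lemma lineThrough_right {p q : ℝ × ℝ} (h : p.1 ≠ q.1) :
    q.2 = (lineThrough p q).1 * q.1 + (lineThrough p q).2 := by
  have := sub_ne_zero.2 h
  simp only [lineThrough]
  field_simp
  ring

/-- Equal ratios give three collinear points on a line that is not axis-parallel. -/
lemma collinear_of_ratio_eq {b b' c d d' e : ℝ} (hb : b ≠ b') (hc : b' + c ≠ 0)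
    (he : d' + e ≠ 0) (h : (b + c) / (b' + c) = (d + e) / (d' + e)) :
    -e = (lineThrough (b, d) (b', d')).1 * -c + (lineThrough (b, d) (b', d')).2 := by
  have := sub_ne_zero.2 hb
  rw [div_eq_div_iff hc he] at h
  simp only [lineThrough]
  field_simp
  linarith

lemma card_ratioTriples (A : Finset ℝ) (hA : 2 ≤ A.card) :
    (A.card : ℝ) ^ 3 / 4 ≤ (ratioTriples A).card := by
  have h : A.card * ((A.card - 1) * (A.card - 1)) ≤ (ratioTriples A).card := by
    have hfib := card_eq_sum_card_fiberwise (s := ratioTriples A) (t := A) (f := fun t => t.2.1)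
      (fun t ht => by
        simp only [ratioTriples, coe_filter, mem_product, Set.mem_ofPred_eq] at ht
        exact ht.1.2.1)
    rw [hfib, ← smul_eq_mul]
    refine card_nsmul_le_sum _ _ _ fun b' hb' => ?_
    have h1 : A.card - 1 ≤ (A.erase b').card := pred_card_le_card_erase
    have h2 : A.card - 1 ≤ (A.erase (-b')).card := pred_card_le_card_erase
    refine (Nat.mul_le_mul h1 h2).trans ?_
    rw [← card_product]
    refine card_le_card_of_injOn (fun z => (z.1, b', z.2)) ?_ ?_
    · rintro ⟨b, c⟩ hz
      simp only [coe_product, coe_erase, Set.mem_prod, Set.mem_sdiff, mem_coe,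
        Set.mem_singleton_iff] at hz
      simp only [ratioTriples, coe_filter, mem_filter, mem_product, Set.mem_ofPred_eq]
      exact ⟨⟨⟨hz.1.1, hb', hz.2.1⟩, hz.1.2, fun h => hz.2.2 (by linarith)⟩, trivial⟩
    · rintro ⟨b, c⟩ _ ⟨b₁, c₁⟩ _ h
      simp only [Prod.mk.injEq] at h ⊢
      tauto
  obtain ⟨m, hm⟩ : ∃ m, A.card = m + 1 := ⟨A.card - 1, by omega⟩
  have h' : (A.card : ℝ) * ((A.card - 1) * (A.card - 1)) ≤ (ratioTriples A).card := by
    rw [hm, Nat.add_sub_cancel] at h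
    rw [hm]
    push_cast
    rw [add_sub_cancel_right]
    exact_mod_cast h
  have hA' : (2 : ℝ) ≤ A.card := by exact_mod_cast hA
  refine le_trans ?_ h'
  have : ((A.card : ℝ) / 2) ^ 2 ≤ (A.card - 1) ^ 2 := by gcongr; linarith
  nlinarith

lemma card_ratio_collisions_le (A : Finset ℝ) :
    (((ratioTriples A ×ˢ ratioTriples A).filter fun z =>
      tripleRatio z.1 = tripleRatio z.2).card : ℝ) ≤
      256 * (Nat.log 2 (A ∪ -A).card + 3 : ℕ) * ((A ∪ -A).card : ℝ) ^ 4 := by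
  classical
  set B := A ∪ -A with hB
  set L := (((B ×ˢ B) ×ˢ (B ×ˢ B)).filter fun z => z.1.1 ≠ z.2.1 ∧ z.1.2 ≠ z.2.2).image
    fun z => lineThrough z.1 z.2 with hLdef
  have hL : ∀ l ∈ L, l.1 ≠ 0 := by
    intro l hl
    obtain ⟨z, hz, rfl⟩ := mem_image.1 hl
    have hz := (mem_filter.1 hz).2
    exact div_ne_zero (sub_ne_zero.2 hz.2) (sub_ne_zero.2 hz.1)
  have hL2 : ∀ l ∈ L, 2 ≤ (gridLine B l).card := by
    intro l hl
    obtain ⟨⟨p, q⟩, hz, rfl⟩ := mem_image.1 hl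
    simp only [mem_filter, mem_product] at hz
    refine one_lt_card.2 ⟨p, mem_gridLine.2 ⟨hz.1.1, lineThrough_left p q⟩,
      q, mem_gridLine.2 ⟨hz.1.2, lineThrough_right hz.2.1⟩, fun h => hz.2.1 (by rw [h])⟩
  refine le_trans ?_ (sum_card_gridLine_cube_le B L hL hL2)
  have : ∑ l ∈ L, ((gridLine B l).card : ℝ) ^ 3 =
      ((L.sigma fun l => gridLine B l ×ˢ gridLine B l ×ˢ gridLine B l).card : ℝ) := by
    rw [card_sigma, Nat.cast_sum]
    refine sum_congr rfl fun l _ => ?_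
    simp only [card_product]
    push_cast
    ring
  rw [this, Nat.cast_le]
  refine card_le_card_of_injOn (fun z => ⟨lineThrough (z.1.1, z.2.1) (z.1.2.1, z.2.2.1),
    (z.1.1, z.2.1), (z.1.2.1, z.2.2.1), (-z.1.2.2, -z.2.2.2)⟩) ?_ ?_
  · rintro ⟨⟨b, b', c⟩, ⟨d, d', e⟩⟩ hz
    obtain ⟨hz, hr⟩ := mem_filter.1 (mem_coe.1 hz)
    simp only [ratioTriples, mem_filter, mem_product] at hz
    obtain ⟨⟨⟨hb, hb', hc⟩, hne, hbc⟩, ⟨hd, hd', he⟩, hne', hde⟩ := hz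
    have inB : ∀ x ∈ A, x ∈ B := fun x hx => mem_union_left _ hx
    have negB : ∀ x ∈ A, -x ∈ B := fun x hx => mem_union_right _ (by simpa using hx)
    simp only [coe_sigma, Set.mem_sigma_iff, mem_coe, mem_product, mem_gridLine]
    refine ⟨mem_image.2 ⟨((b, d), (b', d')), ?_, rfl⟩, ⟨⟨inB _ hb, inB _ hd⟩, ?_⟩,
      ⟨⟨inB _ hb', inB _ hd'⟩, ?_⟩, ⟨⟨negB _ hc, negB _ he⟩, ?_⟩⟩
    · simp only [mem_filter, mem_product]
      exact ⟨⟨⟨inB _ hb, inB _ hd⟩, inB _ hb', inB _ hd'⟩, hne, hne'⟩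
    · exact lineThrough_left (b, d) (b', d')
    · exact lineThrough_right (p := (b, d)) (q := (b', d')) hne
    · exact collinear_of_ratio_eq hne hbc hde hr
  · rintro ⟨⟨b, b', c⟩, ⟨d, d', e⟩⟩ _ ⟨⟨b₁, b₁', c₁⟩, ⟨d₁, d₁', e₁⟩⟩ _ h
    have h := (Sigma.mk.inj h).2
    have h := eq_of_heq h
    simp only [Prod.mk.injEq, neg_inj] at h ⊢
    tauto

lemma card_sq_le_card_image_mul_collisions {α β : Type*} [DecidableEq β] (S : Finset α)
    (f : α → β) :
    S.card ^ 2 ≤ (S.image f).card * ((S ×ˢ S).filter fun z => f z.1 = f z.2).card := by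
  have h1 : S.card = ∑ y ∈ S.image f, (S.filter fun x => f x = y).card :=
    card_eq_sum_card_image f S
  have h2 : ((S ×ˢ S).filter fun z => f z.1 = f z.2).card =
      ∑ y ∈ S.image f, (S.filter fun x => f x = y).card ^ 2 := by
    rw [card_eq_sum_card_fiberwise (t := S.image f) (f := fun z => f z.1)]
    · refine sum_congr rfl fun y _ => ?_
      rw [sq, ← card_product]
      congr 1
      ext ⟨a, b⟩
      simp only [mem_filter, mem_product]
      grind
    · intro z hz
      simp only [coe_filter, mem_product, Set.mem_ofPred_eq] at hz
      exact mem_coe.2 (mem_image_of_mem f hz.1.1)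
  rw [h2]
  conv_lhs => rw [h1]
  exact sq_sum_le_card_mul_sum_sq

theorem stmt_15 :
    ∃ c : ℝ, 0 < c ∧ ∀ A : Finset ℝ,
      2 ≤ A.card →
      c * (A.card : ℝ) ^ 2 / Real.logb 2 (A.card : ℝ)
        ≤ ((((A ×ˢ A ×ˢ A).filter fun t => t.2.1 + t.2.2 ≠ 0).image
            fun t => (t.1 + t.2.2) / (t.2.1 + t.2.2)).card : ℝ) := by
  refine ⟨1 / 327680, by norm_num, fun A hA => ?_⟩
  have hsub : (ratioTriples A).image tripleRatio ⊆
      ((A ×ˢ A ×ˢ A).filter fun t => t.2.1 + t.2.2 ≠ 0).image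
        fun t => (t.1 + t.2.2) / (t.2.1 + t.2.2) :=
    image_subset_image fun t ht => by
      simp only [ratioTriples, mem_filter] at ht ⊢
      exact ⟨ht.1, ht.2.2⟩
  have hsub' := Nat.cast_le (α := ℝ).2 (card_le_card hsub)
  refine le_trans ?_ hsub'
  have hcs := Nat.cast_le (α := ℝ).2
    (card_sq_le_card_image_mul_collisions (ratioTriples A) tripleRatio)
  push_cast at hcs
  have hT := card_ratioTriples A hA
  have hE := card_ratio_collisions_le A
  set E := (((ratioTriples A ×ˢ ratioTriples A).filter fun z =>
      tripleRatio z.1 = tripleRatio z.2).card : ℝ)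
  set R := (((ratioTriples A).image tripleRatio).card : ℝ)
  set B := A ∪ -A with hB
  have hA' : (2 : ℝ) ≤ A.card := by exact_mod_cast hA
  have hAB : A.card ≤ B.card := card_le_card subset_union_left
  have hBA : B.card ≤ 2 * A.card := by
    have : B.card ≤ A.card + (-A).card := card_union_le A (-A)
    rw [card_neg] at this
    omega
  have hBA' : (B.card : ℝ) ≤ 2 * A.card := by exact_mod_cast hBA
  set n := (A.card : ℝ)
  have hlog1 : 1 ≤ Real.logb 2 n := by
    rw [Real.le_logb_iff_rpow_le (by norm_num) (by linarith)]
    simpa using hA'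
  have hlog : ((Nat.log 2 B.card + 3 : ℕ) : ℝ) ≤ 5 * Real.logb 2 n := by
    have h1 : (Nat.log 2 B.card : ℝ) ≤ Real.logb 2 B.card := by
      exact_mod_cast Real.natLog_le_logb B.card 2
    have h2 : Real.logb 2 B.card ≤ Real.logb 2 (2 * n) :=
      Real.logb_le_logb_of_le (by norm_num) (by exact_mod_cast (by omega : 0 < B.card)) hBA'
    rw [Real.logb_mul (by norm_num) (by linarith), Real.logb_self_eq_one (by norm_num)] at h2
    push_cast
    linarith
  have hE' : E ≤ 256 * (5 * Real.logb 2 n) * (2 * n) ^ 4 := hE.trans (by gcongr)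
  have hR : 0 ≤ R := Nat.cast_nonneg _
  have hmain : (n ^ 3 / 4) ^ 2 ≤ R * (256 * (5 * Real.logb 2 n) * (2 * n) ^ 4) :=
    calc (n ^ 3 / 4) ^ 2 ≤ ((ratioTriples A).card : ℝ) ^ 2 := by gcongr
      _ ≤ R * E := hcs
      _ ≤ _ := by gcongr
  rw [div_le_iff₀ (by linarith)]
  have hn4 : 0 < n ^ 4 := by positivity
  refine le_of_mul_le_mul_right ?_ hn4
  nlinarith
end
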